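/- arXiv:math/0611466 — 4 statements merged into one kernel-verified Lean document; each statement's English description precedes it below -/
import Mathlib

section
/- For any three pairwise skew lines of PG(3,q) there exists exactly one regulus of PG(3,q) containing all three of them. -/
/-- A line of PG(3,q): a 2-dimensional subspace of GF(q)^4. -/
def IsLine (F : Type*) [Field F] (l : Submodule F (Fin 4 → F)) : Prop :=
  Module.finrank F l = 2

/-- Two lines meet if their intersection is nonzero. -/
def Meets {F : Type*} [Field F] (m l : Submodule F (Fin 4 → F)) : Prop :=
  m ⊓ l ≠ ⊥

/-- A regulus of PG(3,q): a set of q+1 mutually skew lines such that any line of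
PG(3,q) meeting three of them meets them all. -/
def IsRegulus (q : ℕ) {F : Type*} [Field F] (R : Set (Submodule F (Fin 4 → F))) : Prop :=
  R.ncard = q + 1 ∧
  (∀ l ∈ R, IsLine F l) ∧
  (∀ l₁ ∈ R, ∀ l₂ ∈ R, l₁ ≠ l₂ → l₁ ⊓ l₂ = ⊥) ∧
  (∀ m : Submodule F (Fin 4 → F), IsLine F m →
    (∃ l₁ ∈ R, ∃ l₂ ∈ R, ∃ l₃ ∈ R, l₁ ≠ l₂ ∧ l₁ ≠ l₃ ∧ l₂ ≠ l₃ ∧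
      Meets m l₁ ∧ Meets m l₂ ∧ Meets m l₃) →
    ∀ l ∈ R, Meets m l)

section Pencil

variable {F W V : Type*} [Field F] [AddCommGroup W] [Module F W] [AddCommGroup V] [Module F V]

/-- Two linear maps are jointly injective if the induced map on the product is injective. -/
def JointlyInjective (f g : W →ₗ[F] V) : Prop :=
  ∀ u v, f u + g v = 0 → u = 0 ∧ v = 0

/-- The members of the regulus spanned by two parametrized lines, indexed by the projective
line `Option F`. -/
def regulusLine (f g : W →ₗ[F] V) : Option F → Submodule F V
  | none => LinearMap.range g
  | some c => LinearMap.range (f + c • g)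

/-- The regulus spanned by two parametrized lines. -/
def regulusSet (f g : W →ₗ[F] V) : Set (Submodule F V) :=
  Set.range (regulusLine f g)

/-- Homogeneous coordinates on the projective line `Option F`. -/
def homCoord : Option F → F × F
  | none => (0, 1)
  | some c => (1, c)

/-- The line joining the points of parameter `w` on two parametrized lines. -/
def transversal (f g : W →ₗ[F] V) (w : W) : Submodule F V :=
  Submodule.span F {f w, g w}

lemma homCoord_ne_zero (o : Option F) : (homCoord o).1 ≠ 0 ∨ (homCoord o).2 ≠ 0 := by
  cases o <;> simp [homCoord]

lemma homCoord_det_ne_zero {o o' : Option F} (h : o ≠ o') :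
    (homCoord o).1 * (homCoord o').2 - (homCoord o').1 * (homCoord o).2 ≠ 0 := by
  rcases o with _ | c <;> rcases o' with _ | c' <;> simp_all [homCoord, sub_eq_zero, eq_comm]

lemma mem_regulusLine {f g : W →ₗ[F] V} {o : Option F} {x : V} :
    x ∈ regulusLine f g o ↔ ∃ u, (homCoord o).1 • f u + (homCoord o).2 • g u = x := by
  cases o <;> simp [regulusLine, homCoord]

lemma mem_transversal {f g : W →ₗ[F] V} {w : W} {x : V} :
    x ∈ transversal f g w ↔ ∃ s t : F, s • f w + t • g w = x :=
  Submodule.mem_span_pair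

variable {f g : W →ₗ[F] V}

lemma JointlyInjective.eq_and_eq (hfg : JointlyInjective f g) {u v u' v' : W}
    (h : f u + g v = f u' + g v') : u = u' ∧ v = v' := by
  have := hfg (u - u') (v - v') (by
    rw [map_sub, map_sub, ← sub_eq_zero.2 h]; abel)
  simpa [sub_eq_zero] using this

lemma smul_add_smul_ne_zero (hfg : JointlyInjective f g) {w : W} (hw : w ≠ 0) {s t : F}
    (hst : s ≠ 0 ∨ t ≠ 0) : s • f w + t • g w ≠ 0 := by
  intro h
  have := hfg (s • w) (t • w) (by simpa using h)
  simp [hw] at this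
  tauto

lemma finrank_regulusLine (hfg : JointlyInjective f g) (o : Option F) :
    Module.finrank F (regulusLine f g o) = Module.finrank F W := by
  have key : ∀ h : W →ₗ[F] V,
      (∀ w, h w = (homCoord o).1 • f w + (homCoord o).2 • g w) →
      Module.finrank F (LinearMap.range h) = Module.finrank F W := by
    refine fun h hh => LinearMap.finrank_range_of_inj
      ((injective_iff_map_eq_zero h).2 fun w hw => ?_)
    by_contra hw0
    exact smul_add_smul_ne_zero hfg hw0 (homCoord_ne_zero o) (by rw [← hh, hw])
  cases o with
  | none => exact key _ (by simp [homCoord])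
  | some c => exact key _ (by simp [homCoord])

lemma regulusLine_inf_eq_bot (hfg : JointlyInjective f g) {o o' : Option F} (h : o ≠ o') :
    regulusLine f g o ⊓ regulusLine f g o' = ⊥ := by
  rw [Submodule.eq_bot_iff]
  rintro x ⟨hx, hx'⟩
  obtain ⟨u, rfl⟩ := mem_regulusLine.1 hx
  obtain ⟨v, hv⟩ := mem_regulusLine.1 hx'
  have hdet := homCoord_det_ne_zero h
  generalize homCoord o = p at *
  generalize homCoord o' = p' at *
  obtain ⟨h1, h2⟩ := hfg.eq_and_eq (u := p'.1 • v) (v := p'.2 • v) (u' := p.1 • u)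
    (v' := p.2 • u) (by simpa using hv)
  have hu : (p.1 * p'.2 - p'.1 * p.2) • u = 0 := by
    have : (p.1 * p'.2 - p'.1 * p.2) • u = p'.2 • (p.1 • u) - p'.1 • (p.2 • u) := by module
    rw [this, ← h1, ← h2]
    module
  have hu := (smul_eq_zero.1 hu).resolve_left hdet
  simp [hu]

lemma regulusLine_injective (hfg : JointlyInjective f g) [Nontrivial W]
    [Module.Finite F W] : Function.Injective (regulusLine f g) := by
  intro o o' h
  by_contra hne
  have h1 := regulusLine_inf_eq_bot hfg hne
  rw [← h, inf_idem] at h1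
  have h2 := finrank_regulusLine hfg o
  rw [h1, finrank_bot] at h2
  exact Module.finrank_pos.ne h2

/-- A subspace of dimension at most two containing points of three distinct regulus lines
contains a transversal of the regulus. -/
lemma exists_transversal_le [FiniteDimensional F V] (hfg : JointlyInjective f g)
    {m : Submodule F V}
    (hm : Module.finrank F m ≤ 2) {o₁ o₂ o₃ : Option F} (h₁₂ : o₁ ≠ o₂) (h₁₃ : o₁ ≠ o₃)
    (h₂₃ : o₂ ≠ o₃) (h₁ : m ⊓ regulusLine f g o₁ ≠ ⊥) (h₂ : m ⊓ regulusLine f g o₂ ≠ ⊥)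
    (h₃ : m ⊓ regulusLine f g o₃ ≠ ⊥) : ∃ w ≠ 0, f w ∈ m ∧ g w ∈ m := by
  have point : ∀ o, m ⊓ regulusLine f g o ≠ ⊥ →
      ∃ u ≠ 0, (homCoord o).1 • f u + (homCoord o).2 • g u ∈ m := by
    intro o ho
    obtain ⟨x, ⟨hxm, hx⟩, hx0⟩ := (Submodule.ne_bot_iff _).1 ho
    obtain ⟨u, rfl⟩ := mem_regulusLine.1 hx
    exact ⟨u, by rintro rfl; simp at hx0, hxm⟩
  obtain ⟨u₁, hu₁, hm₁⟩ := point _ h₁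
  obtain ⟨u₂, hu₂, hm₂⟩ := point _ h₂
  obtain ⟨u₃, hu₃, hm₃⟩ := point _ h₃
  have d₁₂ := homCoord_det_ne_zero h₁₂
  have d₁₃ := homCoord_det_ne_zero h₁₃
  have d₂₃ := homCoord_det_ne_zero h₂₃
  generalize homCoord o₁ = p₁ at *
  generalize homCoord o₂ = p₂ at *
  generalize homCoord o₃ = p₃ at *
  have hdep : ¬ LinearIndependent F (![⟨_, hm₁⟩, ⟨_, hm₂⟩, ⟨_, hm₃⟩] : Fin 3 → m) := by
    intro h
    have := h.fintype_card_le_finrank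
    simp at this
    omega
  rw [Fintype.not_linearIndependent_iff] at hdep
  obtain ⟨c, hc, hc0⟩ := hdep
  have hc' := congrArg (Subtype.val) hc
  simp [Fin.sum_univ_three] at hc'
  obtain ⟨e₁, e₂⟩ := hfg
    (c 0 • p₁.1 • u₁ + c 1 • p₂.1 • u₂ + c 2 • p₃.1 • u₃)
    (c 0 • p₁.2 • u₁ + c 1 • p₂.2 • u₂ + c 2 • p₃.2 • u₃) (by
      rw [← hc']; simp only [map_add, map_smul]; module)
  have e₁₂ : (c 0 * (p₁.1 * p₃.2 - p₃.1 * p₁.2)) • u₁ +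
      (c 1 * (p₂.1 * p₃.2 - p₃.1 * p₂.2)) • u₂ = 0 := by
    have := congrArg₂ (fun x y => p₃.2 • x - p₃.1 • y) e₁ e₂
    simp only [smul_zero, sub_zero] at this
    rw [← this]; module
  have e₁₃ : (c 0 * (p₁.1 * p₂.2 - p₂.1 * p₁.2)) • u₁ -
      (c 2 * (p₂.1 * p₃.2 - p₃.1 * p₂.2)) • u₃ = 0 := by
    have := congrArg₂ (fun x y => p₂.2 • x - p₂.1 • y) e₁ e₂
    simp only [smul_zero, sub_zero] at this
    rw [← this]; module
  have c0 : c 0 ≠ 0 := by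
    intro h
    have z1 : c 1 = 0 := by simpa [h, hu₂, d₂₃] using e₁₂
    have z2 : c 2 = 0 := by simpa [h, hu₃, d₂₃] using e₁₃
    obtain ⟨i, hi⟩ := hc0
    fin_cases i <;> simp_all
  obtain ⟨k, hk, hu⟩ : ∃ k : F, k ≠ 0 ∧ k • u₁ ∈ Submodule.span F {u₂} :=
    ⟨_, mul_ne_zero c0 d₁₃, by
      rw [eq_neg_of_add_eq_zero_left e₁₂]
      exact neg_mem (Submodule.smul_mem _ _ (Submodule.mem_span_singleton_self _))⟩
  obtain ⟨r, hr⟩ := Submodule.mem_span_singleton.1 hu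
  have hm₂' : p₂.1 • f u₁ + p₂.2 • g u₁ ∈ m := by
    rw [← Submodule.smul_mem_iff m hk]
    have : k • (p₂.1 • f u₁ + p₂.2 • g u₁) = r • (p₂.1 • f u₂ + p₂.2 • g u₂) := by
      have hf := congrArg f hr
      have hg := congrArg g hr
      rw [map_smul, map_smul] at hf hg
      rw [smul_add, smul_comm k, smul_comm k, ← hf, ← hg]
      module
    rw [this]
    exact m.smul_mem _ hm₂
  refine ⟨u₁, hu₁, ?_, ?_⟩
  · rw [← Submodule.smul_mem_iff m d₁₂]
    have := m.sub_mem (m.smul_mem p₂.2 hm₁) (m.smul_mem p₁.2 hm₂')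
    convert this using 1
    module
  · rw [← Submodule.smul_mem_iff m d₁₂]
    have := m.sub_mem (m.smul_mem p₁.1 hm₂') (m.smul_mem p₂.1 hm₁)
    convert this using 1
    module

/-- A subspace skew to `range g` (or equal to it) and meeting every transversal belongs to the
regulus. -/
lemma mem_regulusSet_of_meets [FiniteDimensional F V] (hW : Module.finrank F W = 2)
    (hfg : JointlyInjective f g)
    {l : Submodule F V} (hl : Module.finrank F l = 2)
    (hskew : l ≠ LinearMap.range g → l ⊓ LinearMap.range g = ⊥)
    (hmeet : ∀ w ≠ 0, ∃ s t : F, (s ≠ 0 ∨ t ≠ 0) ∧ s • f w + t • g w ∈ l) :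
    l ∈ regulusSet f g := by
  by_cases hlg : l = LinearMap.range g
  · exact ⟨none, hlg.symm⟩
  replace hskew := hskew hlg
  have hg0 : ∀ v, g v ∈ l → v = 0 := by
    intro v hv
    have : g v ∈ l ⊓ LinearMap.range g := ⟨hv, v, rfl⟩
    rw [hskew, Submodule.mem_bot] at this
    exact (hfg 0 v (by simpa using this)).2
  have hslope : ∀ w ≠ 0, ∃ c : F, f w + c • g w ∈ l := by
    intro w hw
    obtain ⟨s, t, hst, hmem⟩ := hmeet w hw
    have hs : s ≠ 0 := by
      rintro rfl
      have := hg0 (t • w) (by simpa using hmem)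
      exact (smul_eq_zero.1 this).elim (hst.resolve_left (· rfl)) hw
    refine ⟨s⁻¹ * t, ?_⟩
    rw [← Submodule.smul_mem_iff l hs]
    convert hmem using 1
    rw [smul_add, smul_smul, mul_inv_cancel_left₀ hs]
  have : Module.Finite F W := Module.finite_of_finrank_eq_succ hW
  let b := Module.finBasisOfFinrankEq F W hW
  have hb01 : ∀ x y : F, x • b 0 + y • b 1 = 0 → x = 0 ∧ y = 0 :=
    LinearIndependent.pair_iff.1 (by
      have h : ![b 0, b 1] = b := by ext i; fin_cases i <;> rfl
      exact h ▸ b.linearIndependent)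
  obtain ⟨c₀, h₀⟩ := hslope (b 0) (b.ne_zero 0)
  obtain ⟨c₁, h₁⟩ := hslope (b 1) (b.ne_zero 1)
  obtain ⟨c, h⟩ := hslope (b 0 + b 1) (fun h => by simpa using hb01 1 1 (by simpa using h))
  have hc := hb01 (c - c₀) (c - c₁) (hg0 _ (by
    convert l.sub_mem (l.sub_mem h h₀) h₁ using 1
    simp only [map_add, map_smul]
    module))
  obtain ⟨rfl, hc₁⟩ : c = c₀ ∧ c = c₁ := by simpa [sub_eq_zero] using hc
  subst hc₁
  refine ⟨some c, Submodule.eq_of_le_of_finrank_eq ?_ ?_⟩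
  · rintro _ ⟨w, rfl⟩
    rw [← b.sum_repr w, Fin.sum_univ_two]
    convert l.add_mem (l.smul_mem (b.repr w 0) h₀) (l.smul_mem (b.repr w 1) h₁) using 1
    simp only [map_add, map_smul, LinearMap.add_apply, LinearMap.smul_apply]
  · rw [finrank_regulusLine hfg, hW, hl]

lemma finrank_transversal (hfg : JointlyInjective f g) {w : W} (hw : w ≠ 0) :
    Module.finrank F (transversal f g w) = 2 := by
  have : LinearIndependent F ![f w, g w] := by
    rw [LinearIndependent.pair_iff]
    intro s t h
    by_contra hst
    exact smul_add_smul_ne_zero hfg hw (by tauto) h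
  have h := finrank_span_eq_card this
  rwa [Matrix.range_cons_cons_empty, Fintype.card_fin] at h

end Pencil

lemma isRegulus_regulusSet {F W : Type*} [Field F] [Fintype F] [AddCommGroup W] [Module F W]
    {f g : W →ₗ[F] (Fin 4 → F)} (hW : Module.finrank F W = 2) (hfg : JointlyInjective f g) :
    IsRegulus (Fintype.card F) (regulusSet f g) := by
  have : Module.Finite F W := Module.finite_of_finrank_eq_succ hW
  have : Nontrivial W := Module.nontrivial_of_finrank_eq_succ hW
  refine ⟨?_, ?_, ?_, ?_⟩
  · rw [regulusSet, ← Set.image_univ, Set.ncard_image_of_injective _ (regulusLine_injective hfg),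
      Set.ncard_univ, Nat.card_eq_fintype_card, Fintype.card_option]
  · rintro _ ⟨o, rfl⟩
    exact (finrank_regulusLine hfg o).trans hW
  · rintro _ ⟨o, rfl⟩ _ ⟨o', rfl⟩ h
    exact regulusLine_inf_eq_bot hfg (ne_of_apply_ne _ h)
  · rintro m hm ⟨_, ⟨o₁, rfl⟩, _, ⟨o₂, rfl⟩, _, ⟨o₃, rfl⟩, h₁₂, h₁₃, h₂₃, m₁, m₂, m₃⟩ _ ⟨o, rfl⟩
    obtain ⟨w, hw, hf, hg⟩ := exists_transversal_le hfg (le_of_eq hm) (ne_of_apply_ne _ h₁₂)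
      (ne_of_apply_ne _ h₁₃) (ne_of_apply_ne _ h₂₃) m₁ m₂ m₃
    exact (Submodule.ne_bot_iff _).2
      ⟨_, ⟨m.add_mem (m.smul_mem _ hf) (m.smul_mem _ hg), mem_regulusLine.2 ⟨w, rfl⟩⟩,
        smul_add_smul_ne_zero hfg hw (homCoord_ne_zero o)⟩

/-- Three pairwise skew lines are the images of `f`, `g` and `f + g` for a jointly injective
pair of linear maps on a plane. -/
lemma exists_jointlyInjective_of_skew {F : Type*} [Field F]
    {l₁ l₂ l₃ : Submodule F (Fin 4 → F)}
    (hl₁ : IsLine F l₁) (hl₂ : IsLine F l₂) (hl₃ : IsLine F l₃)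
    (h₁₂ : l₁ ⊓ l₂ = ⊥) (h₁₃ : l₁ ⊓ l₃ = ⊥) (h₂₃ : l₂ ⊓ l₃ = ⊥) :
    ∃ f g : l₃ →ₗ[F] (Fin 4 → F), JointlyInjective f g ∧
      LinearMap.range f = l₁ ∧ LinearMap.range g = l₂ ∧ LinearMap.range (f + g) = l₃ := by
  have hc : IsCompl l₁ l₂ := by
    have hd := disjoint_iff.2 h₁₂
    refine ⟨hd, codisjoint_iff.2 (Submodule.eq_top_of_disjoint _ _ ?_ hd)⟩
    rw [hl₁, hl₂]
    simp
  let f : l₃ →ₗ[F] (Fin 4 → F) := l₁.projection l₂ hc ∘ₗ l₃.subtype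
  let g : l₃ →ₗ[F] (Fin 4 → F) := l₂.projection l₁ hc.symm ∘ₗ l₃.subtype
  have hadd : ∀ u, f u + g u = u := fun u =>
    Submodule.projection_add_projection_eq_self hc u
  have hf : ∀ u, f u ∈ l₁ := fun u => by simp [f]
  have hg : ∀ u, g u ∈ l₂ := fun u => by simp [g]
  have hf0 : ∀ u, f u = 0 → u = 0 := fun u hu => by
    have : (u : Fin 4 → F) ∈ l₂ ⊓ l₃ := ⟨by have := hg u; rwa [← zero_add (g u), ← hu, hadd] at this, u.2⟩
    rw [h₂₃] at this
    simpa using this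
  have hg0 : ∀ u, g u = 0 → u = 0 := fun u hu => by
    have : (u : Fin 4 → F) ∈ l₁ ⊓ l₃ := ⟨by have := hf u; rwa [← add_zero (f u), ← hu, hadd] at this, u.2⟩
    rw [h₁₃] at this
    simpa using this
  refine ⟨f, g, fun u v h => ?_, ?_, ?_, ?_⟩
  · have hu : f u = 0 := by
      have : f u ∈ l₁ ⊓ l₂ :=
        ⟨hf u, by rw [eq_neg_of_add_eq_zero_left h]; exact neg_mem (hg v)⟩
      simpa [h₁₂] using this
    rw [hu, zero_add] at h
    exact ⟨hf0 u hu, hg0 v h⟩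
  · refine Submodule.eq_of_le_of_finrank_eq (by rintro _ ⟨u, rfl⟩; exact hf u) ?_
    rw [LinearMap.finrank_range_of_inj ((injective_iff_map_eq_zero f).2 hf0)]
    exact hl₃.trans hl₁.symm
  · refine Submodule.eq_of_le_of_finrank_eq (by rintro _ ⟨u, rfl⟩; exact hg u) ?_
    rw [LinearMap.finrank_range_of_inj ((injective_iff_map_eq_zero g).2 hg0)]
    exact hl₃.trans hl₂.symm
  · have : f + g = l₃.subtype := LinearMap.ext hadd
    rw [this, Submodule.range_subtype]

/-- For any three pairwise skew lines of PG(3,q) there exists exactly one regulus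
of PG(3,q) containing all three of them. -/
theorem exists_unique_regulus (q : ℕ) (F : Type) [Field F] [Fintype F]
    (hq : Fintype.card F = q)
    (l₁ l₂ l₃ : Submodule F (Fin 4 → F))
    (hl₁ : IsLine F l₁) (hl₂ : IsLine F l₂) (hl₃ : IsLine F l₃)
    (h₁₂ : l₁ ⊓ l₂ = ⊥) (h₁₃ : l₁ ⊓ l₃ = ⊥) (h₂₃ : l₂ ⊓ l₃ = ⊥) :
    ∃! R : Set (Submodule F (Fin 4 → F)),
      IsRegulus q R ∧ l₁ ∈ R ∧ l₂ ∈ R ∧ l₃ ∈ R := by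
  obtain ⟨f, g, hfg, hf, hg, hadd⟩ :=
    exists_jointlyInjective_of_skew hl₁ hl₂ hl₃ h₁₂ h₁₃ h₂₃
  have ne : ∀ {l l' : Submodule F (Fin 4 → F)}, IsLine F l → l ⊓ l' = ⊥ → l ≠ l' := by
    rintro l l' hl h rfl
    rw [inf_idem] at h
    subst h
    simp [IsLine] at hl
  have hR := isRegulus_regulusSet hl₃ hfg
  rw [hq] at hR
  refine ⟨regulusSet f g, ⟨hR, ⟨some 0, by simp [regulusLine, hf]⟩, ⟨none, hg⟩,
    ⟨some 1, by simp [regulusLine, hadd]⟩⟩, ?_⟩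
  rintro R ⟨⟨hcard, hline, hskew, hmeet⟩, h1, h2, h3⟩
  have hfin : (regulusSet f g).Finite := Set.finite_range _
  refine Set.eq_of_subset_of_ncard_le (fun l hl => ?_) (by rw [hcard, hR.1]) hfin
  refine mem_regulusSet_of_meets hl₃ hfg (hline l hl) (hskew l hl _ (hg ▸ h2)) fun w hw => ?_
  have hm := finrank_transversal hfg hw
  have key : ∀ s t : F, (s ≠ 0 ∨ t ≠ 0) → ∀ l' : Submodule F (Fin 4 → F),
      s • f w + t • g w ∈ l' → Meets (transversal f g w) l' := by
    intro s t hst l' hl'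
    exact (Submodule.ne_bot_iff _).2
      ⟨_, ⟨mem_transversal.2 ⟨s, t, rfl⟩, hl'⟩, smul_add_smul_ne_zero hfg hw hst⟩
  have hl := hmeet _ hm ⟨_, h1, _, h2, _, h3, ne hl₁ h₁₂, ne hl₁ h₁₃, ne hl₂ h₂₃,
    key 1 0 (by simp) _ (hf ▸ ⟨w, by simp⟩), key 0 1 (by simp) _ (hg ▸ ⟨w, by simp⟩),
    key 1 1 (by simp) _ (by
      simpa using hadd.le (LinearMap.mem_range_self (f + g) w))⟩ l hl
  obtain ⟨x, ⟨hx, hxl⟩, hx0⟩ := (Submodule.ne_bot_iff _).1 hl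
  obtain ⟨s, t, rfl⟩ := mem_transversal.1 hx
  refine ⟨s, t, ?_, hxl⟩
  by_contra! h
  simp [h] at hx0
end

section
/- Let ℓ1, ℓ2, ℓ3, ℓ4 be four mutually skew lines of PG(3,q) with ℓ4 not in the regulus R(ℓ1,ℓ2,ℓ3), and let T = ⋃_{x ∈ R(ℓ1,ℓ2,ℓ3), x ≠ ℓ1} R(ℓ1, x, ℓ4). Then any two spreads of PG(3,q) both containing T are equal; that is, at most one spread of PG(3,q) contains T. -/
/-- A spread of PG(3,q): a set of q²+1 mutually skew lines. -/
def IsSpread (q : ℕ) {F : Type*} [Field F] (S : Set (Submodule F (Fin 4 → F))) : Prop :=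
  S.ncard = q ^ 2 + 1 ∧
  (∀ l ∈ S, IsLine F l) ∧
  (∀ l₁ ∈ S, ∀ l₂ ∈ S, l₁ ≠ l₂ → l₁ ⊓ l₂ = ⊥)

open Module

variable {F : Type*} [Field F]

section LinearAlgebra

variable {V U W : Type*} [AddCommGroup V] [Module F V] [AddCommGroup U] [Module F U]
  [AddCommGroup W] [Module F W]

/-- Two independent vectors of a 2-dimensional subspace span it. -/
theorem exists_eq_smul_add_smul_of_finrank_eq_two {m : Submodule F V}
    (hm : finrank F m = 2) {p q r : V} (hp : p ∈ m) (hq : q ∈ m) (hr : r ∈ m)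
    (h : LinearIndependent F ![p, q]) : ∃ a b : F, r = a • p + b • q := by
  have : FiniteDimensional F m := .of_finrank_pos (by omega)
  have hspan : Submodule.span F {p, q} = m := by
    refine Submodule.eq_of_le_of_finrank_eq ?_ ?_
    · rw [Submodule.span_le]
      rintro _ (rfl | rfl) <;> assumption
    · rw [hm, ← Matrix.range_cons_cons_empty p q ![], finrank_span_eq_card h, Fintype.card_fin]
  rw [← hspan, Submodule.mem_span_pair] at hr
  obtain ⟨a, b, hab⟩ := hr
  exact ⟨a, b, hab.symm⟩

/-- A linear map which is pointwise a multiple of a bijective linear map is a multiple of it. -/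
theorem exists_eq_smul_of_forall_exists_smul [FiniteDimensional F U] [FiniteDimensional F W]
    {D L : U →ₗ[F] W}
    (hD : Function.Injective D) (hUW : finrank F U = finrank F W)
    (h : ∀ x ≠ 0, ∃ a : F, L x = a • D x) : ∃ a : F, L = a • D := by
  let d := LinearEquiv.ofInjectiveOfFinrankEq D hD hUW
  have hd : ∀ x, d x = D x := fun _ => rfl
  obtain ⟨a, ha⟩ := LinearMap.exists_eq_smul_id_of_forall_notLinearIndependent
    (f := d.symm.toLinearMap ∘ₗ L) (fun v => by
      by_cases hv : v = 0
      · rw [LinearIndependent.pair_iff]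
        intro hi
        simpa using hi 1 0 (by simp [hv])
      · rw [LinearIndependent.pair_iff' hv]
        obtain ⟨a, ha⟩ := h v hv
        simp [ha, ← hd])
  refine ⟨a, LinearMap.ext fun x => ?_⟩
  have := congrArg d (LinearMap.congr_fun ha x)
  have hdd : D (d.symm (L x)) = L x := d.apply_symm_apply (L x)
  simpa [hd, hdd] using this

end LinearAlgebra

section Pencil

variable {U W : Type*} [AddCommGroup U] [Module F U] [AddCommGroup W] [Module F W]
  (e : (U × W) ≃ₗ[F] (Fin 4 → F))

/-- The subspace of `F⁴ ≃ U × W` given by the graph of a linear map `U → W`. -/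
def graphLine (A : U →ₗ[F] W) : Submodule F (Fin 4 → F) :=
  A.graph.map e.toLinearMap

/-- The subspace `0 × W` of `F⁴ ≃ U × W`. -/
def verticalLine : Submodule F (Fin 4 → F) :=
  (LinearMap.ker (LinearMap.fst F U W)).map e.toLinearMap

/-- The vertical line together with the graphs of the maps `A + t D`. -/
def graphPencil (A D : U →ₗ[F] W) : Set (Submodule F (Fin 4 → F)) :=
  insert (verticalLine e) (Set.range fun t : F => graphLine e (A + t • D))

variable {e}

theorem apply_mem_graphLine {A : U →ₗ[F] W} {p : U × W} :
    e p ∈ graphLine e A ↔ p.2 = A p.1 := by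
  simp [graphLine, Submodule.mem_map_equiv]

theorem apply_mem_verticalLine {p : U × W} : e p ∈ verticalLine e ↔ p.1 = 0 := by
  simp [verticalLine, Submodule.mem_map_equiv]

theorem meets_iff {m l : Submodule F (Fin 4 → F)} :
    Meets m l ↔ ∃ p : U × W, p ≠ 0 ∧ e p ∈ m ∧ e p ∈ l := by
  rw [Meets, Submodule.ne_bot_iff]
  constructor
  · rintro ⟨v, ⟨h₁, h₂⟩, h⟩
    exact ⟨e.symm v, by simpa using h, by simpa using h₁, by simpa using h₂⟩
  · rintro ⟨p, hp, h₁, h₂⟩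
    exact ⟨e p, ⟨h₁, h₂⟩, by simpa using hp⟩

theorem meets_verticalLine_iff {m : Submodule F (Fin 4 → F)} :
    Meets m (verticalLine e) ↔ ∃ w ≠ 0, e (0, w) ∈ m := by
  rw [meets_iff (e := e)]
  constructor
  · rintro ⟨⟨x, w⟩, hp, hm, hl⟩
    obtain rfl : x = 0 := apply_mem_verticalLine.1 hl
    exact ⟨w, by simpa using hp, hm⟩
  · rintro ⟨w, hw, hm⟩
    exact ⟨(0, w), by simpa using hw, hm, apply_mem_verticalLine.2 rfl⟩

theorem meets_graphLine_iff {m : Submodule F (Fin 4 → F)} {A : U →ₗ[F] W} :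
    Meets m (graphLine e A) ↔ ∃ x ≠ 0, e (x, A x) ∈ m := by
  rw [meets_iff (e := e)]
  constructor
  · rintro ⟨⟨x, w⟩, hp, hm, hl⟩
    obtain rfl : w = A x := apply_mem_graphLine.1 hl
    exact ⟨x, by rintro rfl; simp at hp, hm⟩
  · rintro ⟨x, hx, hm⟩
    exact ⟨(x, A x), by simp [hx], hm, apply_mem_graphLine.2 rfl⟩

theorem graphLine_inf_eq_bot_iff {A B : U →ₗ[F] W} :
    graphLine e A ⊓ graphLine e B = ⊥ ↔ Function.Injective (B - A) := by
  have h : ¬ Meets (graphLine e A) (graphLine e B) ↔ Function.Injective (B - A) := by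
    rw [meets_graphLine_iff, injective_iff_map_eq_zero]
    simp only [apply_mem_graphLine, LinearMap.sub_apply, sub_eq_zero]
    grind
  simpa [Meets] using h

theorem graphLine_inf_verticalLine (A : U →ₗ[F] W) :
    graphLine e A ⊓ verticalLine e = ⊥ := by
  have h : ¬ Meets (graphLine e A) (verticalLine e) := by
    rw [meets_verticalLine_iff]
    simp [apply_mem_graphLine]
  simpa [Meets] using h

theorem graphLine_injective : Function.Injective (graphLine e) := by
  intro A B h
  ext x
  have : e (x, A x) ∈ graphLine e B := h ▸ apply_mem_graphLine.2 rfl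
  exact apply_mem_graphLine.1 this

theorem isLine_graphLine (hU : finrank F U = 2) (A : U →ₗ[F] W) : IsLine F (graphLine e A) := by
  rw [IsLine, graphLine, LinearEquiv.finrank_map_eq, LinearMap.graph_eq_range_prod,
    LinearMap.finrank_range_of_inj, hU]
  intro x y h
  exact congrArg Prod.fst h

theorem isLine_verticalLine (hW : finrank F W = 2) : IsLine F (verticalLine e) := by
  rw [IsLine, verticalLine, LinearEquiv.finrank_map_eq, LinearMap.ker_fst,
    LinearMap.finrank_range_of_inj LinearMap.inr_injective, hW]

theorem verticalLine_ne_graphLine (hU : finrank F U = 2) (A : U →ₗ[F] W) :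
    verticalLine e ≠ graphLine e A := by
  intro h
  have := graphLine_inf_verticalLine (e := e) A
  rw [h, inf_idem] at this
  have h₂ := isLine_graphLine (e := e) hU A
  rw [IsLine, this, finrank_bot] at h₂
  omega

/-- A line skew to the vertical line is a graph. -/
theorem exists_eq_graphLine (hU : finrank F U = 2) {m : Submodule F (Fin 4 → F)}
    (hm : IsLine F m) (h : m ⊓ verticalLine e = ⊥) : ∃ A, m = graphLine e A := by
  have : FiniteDimensional F U := .of_finrank_pos (by omega)
  let G := m.map e.symm.toLinearMap
  have hG : ∀ p, p ∈ G ↔ e p ∈ m := fun p => by simp [G, Submodule.mem_map_equiv]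
  have hrank : finrank F G = finrank F U := by
    rw [hU, ← hm]
    exact LinearEquiv.finrank_map_eq e.symm m
  have : FiniteDimensional F G := .of_finrank_pos (by omega)
  have hinj : Function.Injective (LinearMap.fst F U W ∘ₗ G.subtype) := by
    rw [injective_iff_map_eq_zero]
    rintro ⟨⟨x, w⟩, hp⟩ hx
    obtain rfl : x = 0 := hx
    by_contra hw
    exact meets_verticalLine_iff.2 ⟨w, by rintro rfl; exact hw rfl, (hG _).1 hp⟩ h
  obtain ⟨A, hA⟩ := Submodule.exists_eq_graph (G := G)
    ⟨hinj, (LinearMap.injective_iff_surjective_of_finrank_eq_finrank hrank).1 hinj⟩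
  refine ⟨A, ?_⟩
  rw [graphLine, ← hA]
  ext v
  simp [G, Submodule.mem_map_equiv]

theorem ncard_graphPencil [Finite F] (hU : finrank F U = 2) (A : U →ₗ[F] W) {D : U →ₗ[F] W}
    (hD : Function.Injective D) : (graphPencil e A D).ncard = Nat.card F + 1 := by
  have : Nontrivial U := nontrivial_of_finrank_pos (R := F) (by omega)
  obtain ⟨u, hu⟩ := exists_ne (0 : U)
  rw [graphPencil, Set.ncard_insert_of_notMem, Set.ncard_range_of_injective]
  · intro s t h
    have := LinearMap.congr_fun (graphLine_injective h) u
    simp only [LinearMap.add_apply, LinearMap.smul_apply, add_right_inj] at this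
    exact smul_left_injective F ((map_ne_zero_iff D hD).2 hu) this
  · rintro ⟨t, ht⟩
    exact verticalLine_ne_graphLine hU _ ht.symm

theorem graphLine_mem_graphPencil_left (A D : U →ₗ[F] W) :
    graphLine e A ∈ graphPencil e A D :=
  .inr ⟨0, by simp⟩

theorem graphLine_mem_graphPencil_sub (A B : U →ₗ[F] W) :
    graphLine e B ∈ graphPencil e A (B - A) :=
  .inr ⟨1, by simp⟩

/-- A line through the two points over `x` meets every member of the pencil. -/
theorem meets_of_mem_graphPencil {m : Submodule F (Fin 4 → F)} {A D : U →ₗ[F] W}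
    (hD : Function.Injective D) {x : U} (hx : x ≠ 0) (h₁ : e (x, A x) ∈ m) (h₂ : e (0, D x) ∈ m) :
    ∀ l ∈ graphPencil e A D, Meets m l := by
  rintro l (rfl | ⟨t, rfl⟩)
  · exact meets_verticalLine_iff.2 ⟨D x, (map_ne_zero_iff D hD).2 hx, h₂⟩
  · refine meets_graphLine_iff.2 ⟨x, hx, ?_⟩
    have := m.add_mem h₁ (m.smul_mem t h₂)
    rw [← map_smul, ← map_add] at this
    simpa using this

theorem meets_of_two_points {m : Submodule F (Fin 4 → F)} {A D : U →ₗ[F] W}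
    (hD : Function.Injective D) {s t : F} (hst : s ≠ t) {x : U} (hx : x ≠ 0)
    (hs : e (x, (A + s • D) x) ∈ m) (ht : e (x, (A + t • D) x) ∈ m) :
    ∀ l ∈ graphPencil e A D, Meets m l := by
  have h₂ : e (0, D x) ∈ m := by
    have := m.smul_mem (s - t)⁻¹ (m.sub_mem hs ht)
    rw [← map_sub, ← map_smul] at this
    have hne : s - t ≠ 0 := sub_ne_zero.2 hst
    simpa [← sub_smul, smul_smul, hne] using this
  refine meets_of_mem_graphPencil hD hx ?_ h₂
  have := m.sub_mem hs (m.smul_mem s h₂)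
  rw [← map_smul, ← map_sub] at this
  simpa using this

/-- A line meeting two graphs and a further member of the pencil meets every member. -/
theorem meets_graphPencil_of_meets {m : Submodule F (Fin 4 → F)} (hm : IsLine F m)
    {A D : U →ₗ[F] W} (hD : Function.Injective D) {s t : F} (hst : s ≠ t)
    (hs : Meets m (graphLine e (A + s • D))) (ht : Meets m (graphLine e (A + t • D)))
    (h : Meets m (verticalLine e) ∨ ∃ r, r ≠ s ∧ r ≠ t ∧ Meets m (graphLine e (A + r • D))) :
    ∀ l ∈ graphPencil e A D, Meets m l := by
  rw [meets_graphLine_iff] at hs ht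
  obtain ⟨x, hx, hxm⟩ := hs
  obtain ⟨y, hy, hym⟩ := ht
  by_cases hxy : ∃ c : F, c • x = y
  · obtain ⟨c, rfl⟩ := hxy
    have hc : c ≠ 0 := by rintro rfl; simp at hy
    refine meets_of_two_points hD hst hx hxm ?_
    have := m.smul_mem c⁻¹ hym
    rw [← map_smul] at this
    simpa [smul_smul, mul_comm _ c, hc] using this
  exfalso
  have hind : LinearIndependent F ![x, y] := (LinearIndependent.pair_iff' hx).2 (by simpa using hxy)
  rw [LinearIndependent.pair_iff] at hind
  have hind' : LinearIndependent F ![e (x, (A + s • D) x), e (y, (A + t • D) y)] := by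
    rw [LinearIndependent.pair_iff]
    intro a b hab
    rw [← map_smul, ← map_smul, ← map_add, LinearEquiv.map_eq_zero_iff] at hab
    exact hind a b (congrArg Prod.fst hab)
  rcases h with h | ⟨r, hrs, hrt, h⟩
  · obtain ⟨w, hw, hwm⟩ := meets_verticalLine_iff.1 h
    obtain ⟨a, b, hab⟩ := exists_eq_smul_add_smul_of_finrank_eq_two hm hxm hym hwm hind'
    rw [← map_smul, ← map_smul, ← map_add, e.injective.eq_iff, Prod.ext_iff] at hab
    obtain ⟨rfl, rfl⟩ := hind a b hab.1.symm
    exact hw (by simpa using hab.2)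
  · obtain ⟨z, hz, hzm⟩ := meets_graphLine_iff.1 h
    obtain ⟨a, b, hab⟩ := exists_eq_smul_add_smul_of_finrank_eq_two hm hxm hym hzm hind'
    rw [← map_smul, ← map_smul, ← map_add, e.injective.eq_iff, Prod.ext_iff] at hab
    obtain ⟨h₁, h₂⟩ := hab
    have h₁ : z = a • x + b • y := h₁
    have h₂ : (A + r • D) z = a • (A + s • D) x + b • (A + t • D) y := h₂
    have h₃ : D ((a * (r - s)) • x + (b * (r - t)) • y) = D 0 := by
      rw [h₁] at h₂
      simp only [LinearMap.add_apply, LinearMap.smul_apply, map_add, map_smul] at h₂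
      simp only [map_add, map_smul, map_zero]
      linear_combination (norm := module) h₂
    obtain ⟨ha, hb⟩ := hind _ _ (hD h₃)
    simp [sub_eq_zero, hrs, hrt] at ha hb
    exact hz (by simp [h₁, ha, hb])

theorem isRegulus_graphPencil [Finite F] (hU : finrank F U = 2) (hW : finrank F W = 2)
    (A : U →ₗ[F] W) {D : U →ₗ[F] W} (hD : Function.Injective D) :
    IsRegulus (Nat.card F) (graphPencil e A D) := by
  refine ⟨ncard_graphPencil hU A hD, ?_, ?_, ?_⟩
  · rintro l (rfl | ⟨t, rfl⟩)
    exacts [isLine_verticalLine hW, isLine_graphLine hU _]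
  · rintro l (rfl | ⟨s, rfl⟩) k (rfl | ⟨t, rfl⟩) hne
    · exact absurd rfl hne
    · rw [inf_comm, graphLine_inf_verticalLine]
    · exact graphLine_inf_verticalLine _
    · have hst : t - s ≠ 0 := sub_ne_zero.2 (by rintro rfl; exact hne rfl)
      rw [graphLine_inf_eq_bot_iff, add_sub_add_left_eq_sub, ← sub_smul]
      intro x y hxy
      exact hD (smul_right_injective W hst hxy)
  · rintro m hm ⟨k₁, h₁, k₂, h₂, k₃, h₃, h₁₂, h₁₃, h₂₃, m₁, m₂, m₃⟩
    have key := fun {s t} => meets_graphPencil_of_meets (e := e) (A := A) hm hD (s := s) (t := t)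
    rcases h₁ with rfl | ⟨r, rfl⟩ <;> rcases h₂ with rfl | ⟨s, rfl⟩ <;>
      rcases h₃ with rfl | ⟨t, rfl⟩ <;> try contradiction
    · exact key (by rintro rfl; exact h₂₃ rfl) m₂ m₃ (.inl m₁)
    · exact key (by rintro rfl; exact h₁₃ rfl) m₁ m₃ (.inl m₂)
    · exact key (by rintro rfl; exact h₁₂ rfl) m₁ m₂ (.inl m₃)
    · exact key (by rintro rfl; exact h₁₂ rfl) m₁ m₂
        (.inr ⟨t, by rintro rfl; exact h₁₃ rfl, by rintro rfl; exact h₂₃ rfl, m₃⟩)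

/-- A regulus is determined by three of its lines. -/
theorem IsRegulus.eq_graphPencil [Finite F] (hU : finrank F U = 2) (hW : finrank F W = 2)
    {A D : U →ₗ[F] W} (hD : Function.Injective D) {R : Set (Submodule F (Fin 4 → F))}
    (hR : IsRegulus (Nat.card F) R) (hv : verticalLine e ∈ R) (hA : graphLine e A ∈ R)
    (hAD : graphLine e (A + D) ∈ R) : R = graphPencil e A D := by
  have : FiniteDimensional F U := .of_finrank_pos (by omega)
  have : FiniteDimensional F W := .of_finrank_pos (by omega)
  have : Nontrivial U := nontrivial_of_finrank_pos (R := F) (by omega)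
  refine Set.eq_of_subset_of_ncard_le ?_ (by rw [hR.1, ncard_graphPencil hU A hD])
    ((Set.finite_range _).insert _)
  intro l hl
  by_cases hlv : l = verticalLine e
  · exact .inl hlv
  obtain ⟨C, rfl⟩ := exists_eq_graphLine hU (hR.2.1 l hl) (hR.2.2.1 l hl _ hv hlv)
  obtain ⟨a, ha⟩ := exists_eq_smul_of_forall_exists_smul (L := C - A) hD (hU.trans hW.symm)
    (fun x hx => by
      let m := Submodule.span F {e (x, A x), e (0, D x)}
      have hind : LinearIndependent F ![e (x, A x), e (0, D x)] := by
        rw [LinearIndependent.pair_iff]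
        intro a b hab
        rw [← map_smul, ← map_smul, ← map_add, LinearEquiv.map_eq_zero_iff, Prod.ext_iff] at hab
        obtain ⟨h₁, h₂⟩ := hab
        obtain rfl : a = 0 := by simpa [hx] using h₁
        exact ⟨rfl, by simpa [(map_ne_zero_iff D hD).2 hx] using h₂⟩
      have hm : IsLine F m := by
        have := finrank_span_eq_card hind
        rwa [Matrix.range_cons_cons_empty, Fintype.card_fin] at this
      have hmeet := meets_of_mem_graphPencil (e := e) (A := A) (m := m) hD hx
        (Submodule.subset_span (by simp)) (Submodule.subset_span (by simp))
      have hne : A ≠ A + D := by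
        intro h
        obtain ⟨u, hu⟩ := exists_ne (0 : U)
        exact (map_ne_zero_iff D hD).2 hu (by simpa using LinearMap.congr_fun h u)
      have := hR.2.2.2 m hm ⟨_, hv, _, hA, _, hAD, verticalLine_ne_graphLine hU _,
        verticalLine_ne_graphLine hU _, graphLine_injective.ne hne, hmeet _ (.inl rfl),
        hmeet _ (.inr ⟨0, by simp⟩), hmeet _ (.inr ⟨1, by simp⟩)⟩ _ hl
      obtain ⟨y, hy, hym⟩ := meets_graphLine_iff.1 this
      obtain ⟨a, b, hab⟩ := Submodule.mem_span_pair.1 hym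
      rw [← map_smul, ← map_smul, ← map_add, e.injective.eq_iff, Prod.ext_iff] at hab
      obtain ⟨h₁, h₂⟩ := hab
      obtain rfl : a • x = y := by simpa using h₁
      have ha : a ≠ 0 := by rintro rfl; simp at hy
      have h₂ : a • A x + b • D x = C (a • x) := h₂
      refine ⟨a⁻¹ * b, smul_right_injective W ha ?_⟩
      simp only [LinearMap.sub_apply, smul_smul, mul_inv_cancel_left₀ ha, smul_sub]
      rw [← map_smul, ← h₂, add_sub_cancel_left])
  exact .inr ⟨a, by simp [← ha]⟩

/-- A spread containing the part of the net spanned by `P` and `Q` obtained from pencils through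
the graph of `Q` is the whole net. -/
theorem IsSpread.eq_net [Finite F] (hU : finrank F U = 2) (hW : finrank F W = 2)
    {P Q : U →ₗ[F] W} (hP : Function.Injective P) (hPQ : ∀ x ≠ 0, ∀ a : F, Q x ≠ a • P x)
    {S : Set (Submodule F (Fin 4 → F))} (hS : IsSpread (Nat.card F) S)
    (hv : verticalLine e ∈ S) (hT : ∀ a t : F, graphLine e (a • P + t • (Q - a • P)) ∈ S) :
    S = insert (verticalLine e)
      (Set.range fun c : F × F => graphLine e (c.1 • P + c.2 • Q)) := by
  have : FiniteDimensional F U := .of_finrank_pos (by omega)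
  have : FiniteDimensional F W := .of_finrank_pos (by omega)
  refine Set.eq_of_subset_of_ncard_le ?_ ?_ ((Set.finite_range _).insert _)
  · intro l hl
    by_cases hlv : l = verticalLine e
    · exact .inl hlv
    right
    obtain ⟨C, rfl⟩ := exists_eq_graphLine hU (hS.2.1 l hl) (hS.2.2 l hl _ hv hlv)
    have hmeet : ∀ a t : F, ∀ x ≠ 0, C x = (a • P + t • (Q - a • P)) x →
        C = a • P + t • (Q - a • P) := by
      intro a t x hx hC
      by_contra hne
      exact meets_graphLine_iff.2 ⟨x, hx, apply_mem_graphLine.2 hC.symm⟩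
        (hS.2.2 _ hl _ (hT a t) (graphLine_injective.ne hne))
    by_cases hex : ∃ a t : F, C = a • P + t • (Q - a • P)
    · obtain ⟨a, t, rfl⟩ := hex
      refine ⟨(a - t * a, t), ?_⟩
      dsimp only
      congr 1
      module
    · obtain ⟨a, ha⟩ := exists_eq_smul_of_forall_exists_smul (L := C - Q) hP (hU.trans hW.symm)
        (fun x hx => by
          have hind : LinearIndependent F ![P x, Q x] :=
            (LinearIndependent.pair_iff' ((map_ne_zero_iff P hP).2 hx)).2
              fun a h => hPQ x hx a h.symm
          obtain ⟨a, b, hab⟩ := exists_eq_smul_add_smul_of_finrank_eq_two (m := ⊤)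
            (by rwa [finrank_top]) trivial trivial (Submodule.mem_top (x := C x)) hind
          by_cases hb : b = 1
          · exact ⟨a, by simp [hab, hb]⟩
          · refine absurd ⟨a / (1 - b), b, hmeet _ _ x hx ?_⟩ hex
            have hb' : 1 - b ≠ 0 := sub_ne_zero.2 (Ne.symm hb)
            have ha : a = a / (1 - b) * (1 - b) := by field_simp
            rw [hab]
            nth_rewrite 1 [ha]
            simp only [LinearMap.add_apply, LinearMap.smul_apply, LinearMap.sub_apply]
            module)
      exact ⟨(a, 1), by simp [← ha]⟩
  · rw [hS.1]
    refine (Set.ncard_insert_le _ _).trans (Nat.add_le_add_right ?_ 1)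
    rw [← Set.image_univ]
    refine (Set.ncard_image_le Set.finite_univ).trans ?_
    rw [Set.ncard_univ, Nat.card_prod, sq]

/-- If a spread contains the graphs of `0`, `P`, `Q` and of the pencil through `P` and `Q`, then
no vector has proportional images under `P` and `Q`, unless `Q` is a multiple of `P`. -/
theorem IsSpread.apply_ne_smul_apply {q : ℕ} {P Q : U →ₗ[F] W}
    (hPQ : Function.Injective (Q - P)) (hne : ∀ a : F, Q ≠ a • P)
    {S : Set (Submodule F (Fin 4 → F))} (hS : IsSpread q S) (h₀ : graphLine e 0 ∈ S)
    (hT : ∀ t : F, graphLine e (P + t • (Q - P)) ∈ S) :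
    ∀ x ≠ 0, ∀ a : F, Q x ≠ a • P x := by
  intro x hx a h
  have ha : 1 - a ≠ 0 := by
    rw [sub_ne_zero]
    rintro rfl
    exact (map_ne_zero_iff _ hPQ).2 hx (by simp [h])
  have hcomb : P + (1 - a)⁻¹ • (Q - P) = (1 - a)⁻¹ • (Q - a • P) := by
    have : P = ((1 - a)⁻¹ * (1 - a)) • P := by rw [inv_mul_cancel₀ ha, one_smul]
    nth_rewrite 1 [this]
    module
  have hmem := hT (1 - a)⁻¹
  rw [hcomb] at hmem
  refine meets_graphLine_iff.2 ⟨x, hx, apply_mem_graphLine.2 ?_⟩ (hS.2.2 _ h₀ _ hmem ?_)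
  · simp [h]
  · refine graphLine_injective.ne (Ne.symm (smul_ne_zero (inv_ne_zero ha) ?_))
    exact sub_ne_zero.2 (hne a)

/-- A spread containing all pencils spanned by the vertical line, a multiple of `P`, and `Q`
is the net spanned by `P` and `Q`. -/
theorem IsSpread.eq_net_of_pencils_subset [Finite F] (hU : finrank F U = 2)
    (hW : finrank F W = 2) {P Q : U →ₗ[F] W} (hP : Function.Injective P)
    (hQ : Function.Injective Q) (hPQ : Function.Injective (Q - P)) (hne : ∀ a : F, Q ≠ a • P)
    {S : Set (Submodule F (Fin 4 → F))} (hS : IsSpread (Nat.card F) S)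
    (hT : ∀ a : F, Function.Injective (Q - a • P) → graphPencil e (a • P) (Q - a • P) ⊆ S) :
    S = insert (verticalLine e)
      (Set.range fun c : F × F => graphLine e (c.1 • P + c.2 • Q)) := by
  have hT₀ : graphPencil e 0 Q ⊆ S := by simpa [hQ] using hT 0
  have hT₁ : graphPencil e P (Q - P) ⊆ S := by simpa [hPQ] using hT 1
  have hind := hS.apply_ne_smul_apply hPQ hne (hT₀ (graphLine_mem_graphPencil_left 0 Q))
    fun t => hT₁ (.inr ⟨t, rfl⟩)
  have hinj : ∀ a : F, Function.Injective (Q - a • P) := fun a => by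
    rw [injective_iff_map_eq_zero]
    intro x hx
    by_contra hx₀
    exact hind x hx₀ a (sub_eq_zero.1 hx)
  exact hS.eq_net hU hW hP hind (hT₀ (.inl rfl)) fun a t => hT a (hinj a) (.inr ⟨t, rfl⟩)

end Pencil

/-- Two skew lines give coordinates on `F⁴`. -/
theorem exists_coordinates {l m : Submodule F (Fin 4 → F)} (hl : IsLine F l) (hm : IsLine F m)
    (h : l ⊓ m = ⊥) :
    ∃ e : (m × l) ≃ₗ[F] (Fin 4 → F), verticalLine e = l ∧ graphLine e 0 = m := by
  have hc : IsCompl m l := by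
    rw [Submodule.isCompl_iff_disjoint, disjoint_comm, disjoint_iff]
    · exact h
    · rw [hl, hm, finrank_fin_fun]
  refine ⟨Submodule.prodEquivOfIsCompl m l hc, ?_, ?_⟩
  · ext v
    obtain ⟨p, rfl⟩ := (Submodule.prodEquivOfIsCompl m l hc).surjective v
    rw [apply_mem_verticalLine, ← Submodule.prodEquivOfIsCompl_symm_apply_fst_eq_zero m l hc,
      LinearEquiv.symm_apply_apply]
  · ext v
    obtain ⟨p, rfl⟩ := (Submodule.prodEquivOfIsCompl m l hc).surjective v
    rw [apply_mem_graphLine, ← Submodule.prodEquivOfIsCompl_symm_apply_snd_eq_zero m l hc,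
      LinearEquiv.symm_apply_apply, LinearMap.zero_apply]

/-- Given four mutually skew lines ℓ₁, ℓ₂, ℓ₃, ℓ₄ with ℓ₄ not in the regulus
R(ℓ₁,ℓ₂,ℓ₃), at most one spread of PG(3,q) contains the set
T = ⋃_{x ∈ R(ℓ₁,ℓ₂,ℓ₃), x ≠ ℓ₁} R(ℓ₁,x,ℓ₄). -/
theorem spread_containing_span_unique (q : ℕ) (F : Type) [Field F] [Fintype F]
    (hq : Fintype.card F = q)
    (l₁ l₂ l₃ l₄ : Submodule F (Fin 4 → F))
    (hl₁ : IsLine F l₁) (hl₂ : IsLine F l₂) (hl₃ : IsLine F l₃) (hl₄ : IsLine F l₄)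
    (h₁₂ : l₁ ⊓ l₂ = ⊥) (h₁₃ : l₁ ⊓ l₃ = ⊥) (h₁₄ : l₁ ⊓ l₄ = ⊥)
    (h₂₃ : l₂ ⊓ l₃ = ⊥) (h₂₄ : l₂ ⊓ l₄ = ⊥) (h₃₄ : l₃ ⊓ l₄ = ⊥)
    (h₄ : ∀ R : Set (Submodule F (Fin 4 → F)),
      IsRegulus q R → l₁ ∈ R → l₂ ∈ R → l₃ ∈ R → l₄ ∉ R)
    (R₁₂₃ : Set (Submodule F (Fin 4 → F)))
    (hR : IsRegulus q R₁₂₃) (hR₁ : l₁ ∈ R₁₂₃) (hR₂ : l₂ ∈ R₁₂₃) (hR₃ : l₃ ∈ R₁₂₃) :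
    let T : Set (Submodule F (Fin 4 → F)) :=
      {m | ∃ x ∈ R₁₂₃, x ≠ l₁ ∧ ∃ R : Set (Submodule F (Fin 4 → F)),
        IsRegulus q R ∧ l₁ ∈ R ∧ x ∈ R ∧ l₄ ∈ R ∧ m ∈ R}
    ∀ S₁ S₂ : Set (Submodule F (Fin 4 → F)),
      IsSpread q S₁ → IsSpread q S₂ → T ⊆ S₁ → T ⊆ S₂ → S₁ = S₂ := by
  have hq : Nat.card F = q := by rw [Nat.card_eq_fintype_card, hq]
  subst hq
  obtain ⟨e, he₁, he₂⟩ := exists_coordinates hl₁ hl₂ h₁₂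
  have hgraph : ∀ l, IsLine F l → l₁ ⊓ l = ⊥ → ∃ A, l = graphLine e A := fun l hl h =>
    exists_eq_graphLine hl₂ hl (by rwa [he₁, inf_comm])
  obtain ⟨P, rfl⟩ := hgraph l₃ hl₃ h₁₃
  obtain ⟨Q, rfl⟩ := hgraph l₄ hl₄ h₁₄
  have hskew : ∀ A, l₂ ⊓ graphLine e A = ⊥ → Function.Injective A := fun A h => by
    rw [← sub_zero A, ← graphLine_inf_eq_bot_iff (e := e)]
    exact (congrArg (· ⊓ graphLine e A) he₂).trans h
  replace h₂₃ := hskew P h₂₃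
  replace h₂₄ := hskew Q h₂₄
  rw [graphLine_inf_eq_bot_iff] at h₃₄
  have hR' := hR.eq_graphPencil (e := e) (A := 0) hl₂ hl₁ h₂₃ (by rwa [he₁]) (by rwa [he₂])
    (by rwa [zero_add])
  have hmem : ∀ a : F, graphLine e (a • P) ∈ R₁₂₃ := fun a => by
    rw [hR']
    exact .inr ⟨a, by simp⟩
  have hne : ∀ a : F, Q ≠ a • P := fun a h => h₄ _ hR hR₁ hR₂ hR₃ (h ▸ hmem a)
  intro T
  have hT : ∀ a : F, Function.Injective (Q - a • P) → graphPencil e (a • P) (Q - a • P) ⊆ T := by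
    intro a ha m hm
    refine ⟨_, hmem a, ?_, _, isRegulus_graphPencil hl₂ hl₁ _ ha, .inl he₁.symm,
      graphLine_mem_graphPencil_left _ _, graphLine_mem_graphPencil_sub _ _, hm⟩
    exact fun h => verticalLine_ne_graphLine hl₂ _ (he₁.trans h.symm)
  have key : ∀ S, IsSpread (Nat.card F) S → T ⊆ S → S = insert (verticalLine e)
      (Set.range fun c : F × F => graphLine e (c.1 • P + c.2 • Q)) := fun S hS hTS =>
    hS.eq_net_of_pencils_subset hl₂ hl₁ h₂₃ h₂₄ h₃₄ hne fun a ha => (hT a ha).trans hTS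
  intro S₁ S₂ hS₁ hS₂ hT₁ hT₂
  rw [key S₁ hS₁ hT₁, key S₂ hS₂ hT₂]
end

section
/- (Thas 1974 construction in the Bruck–Bose model.) Let W be a hyperplane of PG(4,q) (a 4-dimensional subspace of GF(q)^5), let S be a regular spread of the projective 3-space on W, and let O be an ovoid contained in the point set of W such that every line of S meets O in exactly one point. Let V0 be a point of PG(4,q) not in W, and let K̄ be the set of all points P of PG(4,q) not in W such that P lies on the line joining V0 to some point of O. Then K̄ has exactly q^3 − q^2 + q points, and every plane π of PG(4,q) (3-dimensional subspace of GF(q)^5) whose intersection with W is a line of S meets K̄ in either 0 or exactly q points; consequently K̄ corresponds to a maximal (q^3−q^2+q, q)-arc of the Desarguesian plane PG(2,q^2) obtained from S via the Bruck–Bose construction. -/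
/-- A line of the projective 3-space on the hyperplane W of PG(4,q): a
2-dimensional subspace of GF(q)^5 contained in W. -/
def IsLineIn {F : Type*} [Field F] (W l : Submodule F (Fin 5 → F)) : Prop :=
  l ≤ W ∧ Module.finrank F l = 2

/-- A regulus of the projective 3-space on W: q+1 mutually skew lines of W such
that any line of W meeting three of them meets them all. -/
def IsRegulusIn (q : ℕ) {F : Type*} [Field F] (W : Submodule F (Fin 5 → F))
    (R : Set (Submodule F (Fin 5 → F))) : Prop :=
  R.ncard = q + 1 ∧
  (∀ l ∈ R, IsLineIn W l) ∧
  (∀ l₁ ∈ R, ∀ l₂ ∈ R, l₁ ≠ l₂ → l₁ ⊓ l₂ = ⊥) ∧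
  (∀ m : Submodule F (Fin 5 → F), IsLineIn W m →
    (∃ l₁ ∈ R, ∃ l₂ ∈ R, ∃ l₃ ∈ R, l₁ ≠ l₂ ∧ l₁ ≠ l₃ ∧ l₂ ≠ l₃ ∧
      m ⊓ l₁ ≠ ⊥ ∧ m ⊓ l₂ ≠ ⊥ ∧ m ⊓ l₃ ≠ ⊥) →
    ∀ l ∈ R, m ⊓ l ≠ ⊥)

/-- A regular spread of the projective 3-space on W: q²+1 mutually skew lines of W
such that the regulus through any three of them is contained in the spread. -/
def IsRegularSpreadIn (q : ℕ) {F : Type*} [Field F] (W : Submodule F (Fin 5 → F))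
    (S : Set (Submodule F (Fin 5 → F))) : Prop :=
  S.ncard = q ^ 2 + 1 ∧
  (∀ l ∈ S, IsLineIn W l) ∧
  (∀ l₁ ∈ S, ∀ l₂ ∈ S, l₁ ≠ l₂ → l₁ ⊓ l₂ = ⊥) ∧
  (∀ l₁ ∈ S, ∀ l₂ ∈ S, ∀ l₃ ∈ S, l₁ ≠ l₂ → l₁ ≠ l₃ → l₂ ≠ l₃ →
    ∀ R : Set (Submodule F (Fin 5 → F)),
      IsRegulusIn q W R → l₁ ∈ R → l₂ ∈ R → l₃ ∈ R → R ⊆ S)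

/-- An ovoid of the projective 3-space on W: q²+1 points (1-dimensional subspaces
of W), no three of which are collinear. -/
def IsOvoidIn (q : ℕ) {F : Type*} [Field F] (W : Submodule F (Fin 5 → F))
    (O : Set (Submodule F (Fin 5 → F))) : Prop :=
  O.ncard = q ^ 2 + 1 ∧
  (∀ P ∈ O, P ≤ W ∧ Module.finrank F P = 1) ∧
  (∀ P₁ ∈ O, ∀ P₂ ∈ O, ∀ P₃ ∈ O, P₁ ≠ P₂ → P₁ ≠ P₃ → P₂ ≠ P₃ →
    Module.finrank F ((P₁ ⊔ P₂ ⊔ P₃ : Submodule F (Fin 5 → F)) : Submodule F (Fin 5 → F)) = 3)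

section ProjectiveCounting

variable {F V : Type*} [Field F] [AddCommGroup V] [Module F V] [Finite V]

lemma Submodule.ncard_coe_eq_pow_finrank (A : Submodule F V) :
    (A : Set V).ncard = Nat.card F ^ Module.finrank F A := by
  rw [← Module.natCard_eq_pow_finrank (K := F) (V := A), Set.ncard_def, Set.encard, Nat.card]
  rfl

lemma Submodule.ncard_diff (A N : Submodule F V) :
    ((A : Set V) \ N).ncard =
      Nat.card F ^ Module.finrank F A - Nat.card F ^ Module.finrank F (A ⊓ N : Submodule F V) := by
  rw [← A.ncard_coe_eq_pow_finrank, ← (A ⊓ N).ncard_coe_eq_pow_finrank,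
    ← Set.sdiff_inter_self_eq_sdiff,
    Set.ncard_sdiff Set.inter_subset_right (Set.toFinite _), Submodule.coe_inf, Set.inter_comm]

lemma Submodule.ncard_biUnion_diff (T : Set (Submodule F V)) (N : Submodule F V) (c : ℕ)
    (hT : ∀ A ∈ T, ∀ B ∈ T, A ≠ B → A ⊓ B ≤ N)
    (hc : ∀ A ∈ T, ((A : Set V) \ N).ncard = c) :
    (⋃ A ∈ T, ((A : Set V) \ N)).ncard = T.ncard * c := by
  classical
  have hfin : T.Finite := Set.toFinite T
  rw [Set.ncard_eq_toFinset_card T hfin, ← smul_eq_mul, ← Finset.sum_const,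
    Set.Finite.ncard_biUnion hfin (fun _ _ => Set.toFinite _)]
  · rw [finsum_mem_eq_finite_toFinset_sum _ hfin]
    exact Finset.sum_congr rfl fun A hA => hc A (by simpa using hA)
  · intro A hA B hB hAB
    refine Set.disjoint_left.2 fun x hx hx' => hx.2 (hT A hA B hB hAB ⟨hx.1, hx'.1⟩)

/-- A family of submodules of `M` that are pairwise disjoint outside `N` has bounded size. -/
lemma Submodule.ncard_mul_le_ncard_diff (T : Set (Submodule F V)) (M N : Submodule F V) (c : ℕ)
    (hM : ∀ A ∈ T, A ≤ M) (hT : ∀ A ∈ T, ∀ B ∈ T, A ≠ B → A ⊓ B ≤ N)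
    (hc : ∀ A ∈ T, ((A : Set V) \ N).ncard = c) :
    T.ncard * c ≤ ((M : Set V) \ N).ncard := by
  rw [← Submodule.ncard_biUnion_diff T N c hT hc]
  refine Set.ncard_le_ncard ?_ (Set.toFinite _)
  exact Set.iUnion₂_subset fun A hA => Set.sdiff_subset_sdiff_left (hM A hA)

lemma Submodule.inf_eq_bot_of_finrank_eq_one {A B : Submodule F V} (hA : Module.finrank F A = 1)
    (hAB : ¬ A ≤ B) : A ⊓ B = ⊥ := by
  have : Module.finrank F (A ⊓ B : Submodule F V) < Module.finrank F A :=
    Submodule.finrank_lt_finrank_of_lt (lt_of_le_of_ne inf_le_left fun h => hAB (inf_eq_left.1 h))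
  exact Submodule.finrank_eq_zero.1 (by omega)

lemma Submodule.finrank_sup_of_finrank_eq_one {A B : Submodule F V} (hA : Module.finrank F A = 1)
    (hAB : ¬ A ≤ B) : Module.finrank F (B ⊔ A : Submodule F V) = Module.finrank F B + 1 := by
  have h := Submodule.finrank_sup_add_finrank_inf_eq B A
  rw [inf_comm, Submodule.inf_eq_bot_of_finrank_eq_one hA hAB, finrank_bot, hA] at h
  omega

lemma Submodule.le_iff_eq_of_finrank_eq_one {A B : Submodule F V} (hA : Module.finrank F A = 1)
    (hB : Module.finrank F B = 1) : A ≤ B ↔ A = B :=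
  ⟨fun h => Submodule.eq_of_le_of_finrank_eq h (by rw [hA, hB]), fun h => h.le⟩

lemma Submodule.eq_span_singleton_of_finrank_eq_one {A : Submodule F V}
    (hA : Module.finrank F A = 1) {v : V} (hv : v ∈ A) (hv0 : v ≠ 0) :
    Submodule.span F {v} = A :=
  Submodule.eq_of_le_of_finrank_eq ((Submodule.span_singleton_le_iff_mem v A).2 hv)
    (by rw [finrank_span_singleton hv0, hA])

/-- The number of vectors on the cone over a set of points is determined by their number. -/
lemma ncard_cone {O : Set (Submodule F V)} (hpt : ∀ P ∈ O, Module.finrank F P = 1)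
    (hne : O.Nonempty) :
    {v : V | ∃ Q ∈ O, v ∈ Q}.ncard = O.ncard * (Nat.card F - 1) + 1 := by
  have hU : {v : V | ∃ Q ∈ O, v ∈ Q} =
      insert 0 (⋃ A ∈ O, ((A : Set V) \ (⊥ : Submodule F V))) := by
    ext v
    simp only [Set.mem_ofPred_eq, Set.mem_insert_iff, Set.mem_iUnion, Set.mem_sdiff, SetLike.mem_coe,
      Submodule.mem_bot, exists_prop]
    constructor
    · rintro ⟨Q, hQ, hv⟩
      by_cases h : v = 0
      · exact Or.inl h
      · exact Or.inr ⟨Q, hQ, hv, h⟩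
    · rintro (rfl | ⟨Q, hQ, hv, -⟩)
      · exact ⟨hne.some, hne.some_mem, zero_mem _⟩
      · exact ⟨Q, hQ, hv⟩
  rw [hU, Set.ncard_insert_of_notMem (by simp) (Set.toFinite _),
    Submodule.ncard_biUnion_diff O ⊥ (Nat.card F - 1)]
  · intro A hA B hB hAB
    rw [Submodule.inf_eq_bot_of_finrank_eq_one (hpt A hA)
      (by rwa [Submodule.le_iff_eq_of_finrank_eq_one (hpt A hA) (hpt B hB)])]
  · intro A hA
    rw [Submodule.ncard_diff, inf_bot_eq, finrank_bot, hpt A hA, pow_one, pow_zero]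

/-- The translate of `l` by `w ∉ l` meets the cone over `O` once in each point of `O` that lies in
the span of `l` and `w` but not in `l`. -/
lemma ncard_cone_inter_translate {O : Set (Submodule F V)}
    (hpt : ∀ P ∈ O, Module.finrank F P = 1) {l : Submodule F V} {w : V} (hw : w ∉ l) :
    {v : V | (∃ Q ∈ O, v ∈ Q) ∧ v - w ∈ l}.ncard =
      {P ∈ O | P ≤ l ⊔ Submodule.span F {w} ∧ ¬ P ≤ l}.ncard := by
  have hnot : ∀ v, v - w ∈ l → v ∉ l := fun v hv hvl => hw (by simpa using l.sub_mem hvl hv)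
  have hne : ∀ v, v - w ∈ l → v ≠ 0 := fun v hv h => hnot v hv (h ▸ zero_mem l)
  refine Set.BijOn.ncard_eq (f := fun v => Submodule.span F {v}) ⟨?_, ?_, ?_⟩
  · rintro v ⟨⟨Q, hQ, hvQ⟩, hv⟩
    have hspan := Submodule.eq_span_singleton_of_finrank_eq_one (hpt Q hQ) hvQ (hne v hv)
    refine ⟨by rwa [← hspan] at hQ, ?_,
      fun h => hnot v hv ((Submodule.span_singleton_le_iff_mem v l).1 h)⟩
    rw [Submodule.span_singleton_le_iff_mem, ← sub_add_cancel v w]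
    exact Submodule.add_mem_sup hv (Submodule.mem_span_singleton_self w)
  · rintro v ⟨-, hv⟩ u ⟨-, hu⟩ huv
    obtain ⟨c, rfl⟩ := Submodule.mem_span_singleton.1
      ((show Submodule.span F {v} = Submodule.span F {u} from huv) ▸
        Submodule.mem_span_singleton_self u)
    have h : (1 - c) • v ∈ l := by
      have := l.sub_mem hv hu
      rwa [sub_sub_sub_cancel_right, ← one_smul F v, smul_smul, mul_one,
        ← sub_smul] at this
    by_cases hc : 1 - c = 0
    · rw [← sub_eq_zero.1 hc, one_smul]
    · exact absurd ((l.smul_mem_iff hc).1 h) (hnot v hv)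
  · rintro P ⟨hP, hPα, hPl⟩
    obtain ⟨u, huP, hul⟩ := SetLike.not_le_iff_exists.1 hPl
    obtain ⟨a, ha, b, hb, rfl⟩ := Submodule.mem_sup.1 (hPα huP)
    obtain ⟨c, rfl⟩ := Submodule.mem_span_singleton.1 hb
    have hc : c ≠ 0 := by
      rintro rfl
      exact hul (by simpa using ha)
    have hmem : c⁻¹ • (a + c • w) - w ∈ l := by
      rw [smul_add, inv_smul_smul₀ hc, add_sub_cancel_right]
      exact l.smul_mem _ ha
    have hvP : c⁻¹ • (a + c • w) ∈ P := P.smul_mem _ huP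
    exact ⟨_, ⟨⟨P, hP, hvP⟩, hmem⟩,
      Submodule.eq_span_singleton_of_finrank_eq_one (hpt P hP) hvP (hne _ hmem)⟩

variable [Finite F]

/-- There are at most `q + 1` submodules of dimension `k + 1` between a submodule of dimension `k`
and one of dimension `k + 2`. -/
lemma Submodule.ncard_pencil_le (T : Set (Submodule F V)) (L M : Submodule F V)
    (hLM : Module.finrank F M = Module.finrank F L + 2)
    (hT : ∀ A ∈ T, L ≤ A ∧ A ≤ M ∧ Module.finrank F A = Module.finrank F L + 1)
    (hL : L ≤ M) : T.ncard ≤ Nat.card F + 1 := by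
  have hq : 1 < Nat.card F := Finite.one_lt_card
  have h := Submodule.ncard_mul_le_ncard_diff T M L
    (Nat.card F ^ (Module.finrank F L + 1) - Nat.card F ^ Module.finrank F L)
    (fun A hA => (hT A hA).2.1) ?_ ?_
  · rw [Submodule.ncard_diff, inf_eq_right.2 hL, hLM] at h
    have hpos : 0 < Nat.card F ^ Module.finrank F L := by positivity
    have e1 : Nat.card F ^ (Module.finrank F L + 1) - Nat.card F ^ Module.finrank F L =
      Nat.card F ^ Module.finrank F L * (Nat.card F - 1) := by
      rw [pow_succ, Nat.mul_sub_one]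
    have e2 : Nat.card F ^ (Module.finrank F L + 2) - Nat.card F ^ Module.finrank F L =
      Nat.card F ^ Module.finrank F L * (Nat.card F - 1) * (Nat.card F + 1) := by
      obtain ⟨r, hr⟩ := Nat.exists_eq_add_of_lt hq
      rw [hr, show 1 + r + 1 - 1 = r + 1 by omega, Nat.sub_eq_iff_eq_add (by
        exact Nat.pow_le_pow_right (by omega) (by omega))]
      ring
    rw [e1, e2, mul_comm] at h
    refine Nat.le_of_mul_le_mul_left h (Nat.mul_pos (by positivity) (by omega))
  · intro A hA B hB hAB
    have hle : L ≤ A ⊓ B := le_inf (hT A hA).1 (hT B hB).1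
    have h1 : Module.finrank F (A ⊓ B : Submodule F V) < Module.finrank F A := by
      refine Submodule.finrank_lt_finrank_of_lt (lt_of_le_of_ne inf_le_left fun h => hAB ?_)
      exact Submodule.eq_of_le_of_finrank_eq (inf_eq_left.1 h) (by rw [(hT A hA).2.2, (hT B hB).2.2])
    rw [(hT A hA).2.2] at h1
    exact (Submodule.eq_of_le_of_finrank_le hle (by omega)).ge
  · intro A hA
    rw [Submodule.ncard_diff, inf_eq_right.2 (hT A hA).1, (hT A hA).2.2]

/-- A spread of a 3-space has a line in every plane of that space. -/
lemma exists_mem_spread_le_of_finrank_eq_three {W : Submodule F V} (hW : Module.finrank F W = 4)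
    {S : Set (Submodule F V)} (hcard : S.ncard = Nat.card F ^ 2 + 1)
    (hline : ∀ l ∈ S, l ≤ W ∧ Module.finrank F l = 2)
    (hskew : ∀ l₁ ∈ S, ∀ l₂ ∈ S, l₁ ≠ l₂ → l₁ ⊓ l₂ = ⊥)
    {α : Submodule F V} (hαW : α ≤ W) (hα : Module.finrank F α = 3) : ∃ l ∈ S, l ≤ α := by
  by_contra! hcon
  have hq : 1 < Nat.card F := Finite.one_lt_card
  have h := Submodule.ncard_mul_le_ncard_diff S W α (Nat.card F ^ 2 - Nat.card F ^ 1)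
    (fun l hl => (hline l hl).1) (fun l hl m hm hlm => by simp [hskew l hl m hm hlm]) ?_
  · rw [hcard, Submodule.ncard_diff, inf_eq_right.2 hαW, hW, hα] at h
    obtain ⟨r, hr⟩ := Nat.exists_eq_add_of_lt hq
    rw [hr] at h
    zify [Nat.pow_le_pow_right (show 0 < 1 + r + 1 by omega) (show 1 ≤ 2 by omega),
      Nat.pow_le_pow_right (show 0 < 1 + r + 1 by omega) (show 3 ≤ 4 by omega)] at h
    nlinarith
  · intro l hl
    have h1 : Module.finrank F (l ⊓ α : Submodule F V) < Module.finrank F l :=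
      Submodule.finrank_lt_finrank_of_lt
        (lt_of_le_of_ne inf_le_left fun h => hcon l hl (inf_eq_left.1 h))
    have h2 := Submodule.finrank_sup_add_finrank_inf_eq l α
    have h3 := Submodule.finrank_mono (sup_le (hline l hl).1 hαW)
    have h4 := (hline l hl).2
    rw [Submodule.ncard_diff, h4, show Module.finrank F (l ⊓ α : Submodule F V) = 1 by omega]

/-- A plane section of a cap that admits a tangent line has at most `q + 1` points. -/
lemma ncard_cap_inter_plane_le
    {O : Set (Submodule F V)} (hpt : ∀ P ∈ O, Module.finrank F P = 1)
    (hcap : ∀ P₁ ∈ O, ∀ P₂ ∈ O, ∀ P₃ ∈ O, P₁ ≠ P₂ → P₁ ≠ P₃ → P₂ ≠ P₃ →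
      Module.finrank F (P₁ ⊔ P₂ ⊔ P₃ : Submodule F V) = 3)
    {α l : Submodule F V} (hα : Module.finrank F α = 3)
    (hl : Module.finrank F l = 2) (hlα : l ≤ α) (htan : ∃! P, P ∈ O ∧ P ≤ l) :
    {P ∈ O | P ≤ α}.ncard ≤ Nat.card F + 1 := by
  obtain ⟨Q, ⟨hQ, hQl⟩, huniq⟩ := htan
  have hsup : ∀ P ∈ O, P ≠ Q → Module.finrank F (Q ⊔ P : Submodule F V) = 2 := fun P hP hPQ => by
    rw [Submodule.finrank_sup_of_finrank_eq_one (hpt P hP)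
      (by rwa [Submodule.le_iff_eq_of_finrank_eq_one (hpt P hP) (hpt Q hQ)]), hpt Q hQ]
  set f : Submodule F V → Submodule F V := fun P => if P = Q then l else Q ⊔ P with hf
  have hinj : Set.InjOn f {P ∈ O | P ≤ α} := by
    classical
    have key : ∀ P ∈ O, P ≠ Q → Q ⊔ P ≠ l := fun P hP hPQ h =>
      hPQ (huniq P ⟨hP, h ▸ le_sup_right⟩)
    intro P hP R hR hPR
    simp only [hf] at hPR
    split_ifs at hPR with h1 h2 h2
    · rw [h1, h2]
    · exact absurd hPR.symm (key R hR.1 h2)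
    · exact absurd hPR (key P hP.1 h1)
    · by_contra hne
      have := hcap Q hQ P hP.1 R hR.1 (Ne.symm h1) (Ne.symm h2) hne
      rw [sup_eq_left.2 (hPR ▸ le_sup_right : R ≤ Q ⊔ P), hsup P hP.1 h1] at this
      omega
  rw [← hinj.ncard_image]
  refine Submodule.ncard_pencil_le _ Q α (by rw [hα, hpt Q hQ]) ?_ (hQl.trans hlα)
  rintro _ ⟨P, hP, rfl⟩
  by_cases h : P = Q
  · rw [show f P = l from if_pos h]
    exact ⟨hQl, hlα, by rw [hl, hpt Q hQ]⟩
  · rw [show f P = Q ⊔ P from if_neg h]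
    exact ⟨le_sup_left, sup_le (hQl.trans hlα) hP.2, by rw [hsup P hP.1 h, hpt Q hQ]⟩

/-- If all plane sections of an ovoid have at most `q + 1` points, then every plane
through two of its points meets it in exactly `q + 1` points. -/
lemma ncard_ovoid_inter_plane_eq
    {O : Set (Submodule F V)} (hpt : ∀ P ∈ O, Module.finrank F P = 1)
    (hcap : ∀ P₁ ∈ O, ∀ P₂ ∈ O, ∀ P₃ ∈ O, P₁ ≠ P₂ → P₁ ≠ P₃ → P₂ ≠ P₃ →
      Module.finrank F (P₁ ⊔ P₂ ⊔ P₃ : Submodule F V) = 3)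
    {W : Submodule F V} (hW : Module.finrank F W = 4)
    (hcard : O.ncard = Nat.card F ^ 2 + 1) (hOW : ∀ P ∈ O, P ≤ W)
    (hle : ∀ α ≤ W, Module.finrank F α = 3 → {P ∈ O | P ≤ α}.ncard ≤ Nat.card F + 1)
    {α : Submodule F V} (hαW : α ≤ W) (hα : Module.finrank F α = 3)
    {P₁ P₂ : Submodule F V} (h₁ : P₁ ∈ O) (h₂ : P₂ ∈ O) (hne : P₁ ≠ P₂)
    (h₁α : P₁ ≤ α) (h₂α : P₂ ≤ α) : {P ∈ O | P ≤ α}.ncard = Nat.card F + 1 := by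
  classical
  have hq : 1 < Nat.card F := Finite.one_lt_card
  refine le_antisymm (hle α hαW hα) ?_
  have hL : Module.finrank F (P₁ ⊔ P₂ : Submodule F V) = 2 := by
    rw [Submodule.finrank_sup_of_finrank_eq_one (hpt P₂ h₂)
      (by rwa [Submodule.le_iff_eq_of_finrank_eq_one (hpt P₂ h₂) (hpt P₁ h₁), eq_comm]), hpt P₁ h₁]
  set O' : Finset (Submodule F V) := (O \ {P₁, P₂}).toFinite.toFinset with hO'
  have hmem : ∀ R, R ∈ O' ↔ R ∈ O ∧ R ≠ P₁ ∧ R ≠ P₂ := fun R => by simp [hO']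
  have hpair : ({P₁, P₂} : Set (Submodule F V)) ⊆ O := by
    rintro _ (rfl | rfl) <;> assumption
  have hO'card : O'.card = Nat.card F ^ 2 - 1 := by
    rw [hO', ← Set.ncard_eq_toFinset_card, Set.ncard_sdiff hpair (Set.toFinite _), hcard,
      Set.ncard_pair hne]
    omega
  have h3 : ∀ R ∈ O', Module.finrank F (P₁ ⊔ P₂ ⊔ R : Submodule F V) = 3 := fun R hR => by
    rw [hmem] at hR
    exact hcap _ h₁ _ h₂ _ hR.1 hne hR.2.1.symm hR.2.2.symm
  set B : Finset (Submodule F V) := O'.image (fun R => P₁ ⊔ P₂ ⊔ R) with hB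
  have hBW : ∀ β ∈ insert α B, P₁ ⊔ P₂ ≤ β ∧ β ≤ W ∧ Module.finrank F β = 3 := by
    intro β hβ
    rcases Finset.mem_insert.1 hβ with rfl | hβ
    · exact ⟨sup_le h₁α h₂α, hαW, hα⟩
    · obtain ⟨R, hR, rfl⟩ := Finset.mem_image.1 hβ
      exact ⟨le_sup_left, sup_le (sup_le (hOW _ h₁) (hOW _ h₂)) (hOW _ ((hmem R).1 hR).1), h3 R hR⟩
  have hBcard : (insert α B).card ≤ Nat.card F + 1 := by
    rw [← Set.ncard_coe_finset]
    exact Submodule.ncard_pencil_le _ (P₁ ⊔ P₂) W (by rw [hW, hL])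
      (fun β hβ => by rw [hL]; exact hBW β hβ) (sup_le (hOW _ h₁) (hOW _ h₂))
  have hfiber : ∀ β ∈ insert α B, (O'.filter fun R => P₁ ⊔ P₂ ⊔ R = β).card + 2 ≤
      {P ∈ O | P ≤ β}.ncard := by
    intro β hβ
    have hsub : ({P₁, P₂} : Set (Submodule F V)) ⊆ {P ∈ O | P ≤ β} := by
      rintro _ (rfl | rfl)
      · exact ⟨h₁, le_sup_left.trans (hBW β hβ).1⟩
      · exact ⟨h₂, le_sup_right.trans (hBW β hβ).1⟩
    rw [← Set.ncard_pair hne, ← Set.ncard_sdiff_add_ncard_of_subset hsub (Set.toFinite _),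
      ← Set.ncard_coe_finset]
    refine Nat.add_le_add_right (Set.ncard_le_ncard ?_ (Set.toFinite _)) _
    intro R hR
    simp only [Finset.coe_filter, Set.mem_ofPred_eq, hmem] at hR
    exact ⟨⟨hR.1.1, hR.2 ▸ le_sup_right⟩, by simp [hR.1.2.1, hR.1.2.2]⟩
  have hsum := Finset.card_eq_sum_card_fiberwise (f := fun R => P₁ ⊔ P₂ ⊔ R) (s := O')
    (t := insert α B) fun R hR => Finset.mem_coe.2 <|
      Finset.mem_insert_of_mem (Finset.mem_image_of_mem _ hR)
  rw [← Finset.add_sum_erase _ _ (Finset.mem_insert_self α B), hO'card] at hsum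
  have hrest : ∑ β ∈ (insert α B).erase α, (O'.filter fun R => P₁ ⊔ P₂ ⊔ R = β).card ≤
      Nat.card F * (Nat.card F - 1) := by
    refine (Finset.sum_le_card_nsmul _ _ (Nat.card F - 1) fun β hβ => ?_).trans ?_
    · have hβ' := Finset.mem_of_mem_erase hβ
      have h5 := hfiber β hβ'
      have h6 := hle β (hBW β hβ').2.1 (hBW β hβ').2.2
      omega
    · rw [smul_eq_mul, Finset.card_erase_of_mem (Finset.mem_insert_self α B)]
      exact Nat.mul_le_mul_right _ (by omega)
  have hα2 := hfiber α (Finset.mem_insert_self α B)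
  obtain ⟨r, hr⟩ := Nat.exists_eq_add_of_lt hq
  rw [hr] at hsum hrest ⊢
  rw [show 1 + r + 1 - 1 = r + 1 by omega] at hrest
  have : (1 + r + 1) ^ 2 - 1 = (1 + r + 1) * (r + 1) + (r + 1) := by
    rw [Nat.sub_eq_iff_eq_add (Nat.one_le_pow _ _ (by omega))]
    ring
  omega

/-- Translates of a spread line meet the cone over the ovoid in `0` or `q` vectors. -/
lemma ncard_ovoid_cone_inter_translate {W : Submodule F V} (hW : Module.finrank F W = 4)
    {S : Set (Submodule F V)} (hScard : S.ncard = Nat.card F ^ 2 + 1)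
    (hline : ∀ l ∈ S, l ≤ W ∧ Module.finrank F l = 2)
    (hskew : ∀ l₁ ∈ S, ∀ l₂ ∈ S, l₁ ≠ l₂ → l₁ ⊓ l₂ = ⊥)
    {O : Set (Submodule F V)} (hOcard : O.ncard = Nat.card F ^ 2 + 1)
    (hpt : ∀ P ∈ O, P ≤ W ∧ Module.finrank F P = 1)
    (hcap : ∀ P₁ ∈ O, ∀ P₂ ∈ O, ∀ P₃ ∈ O, P₁ ≠ P₂ → P₁ ≠ P₃ → P₂ ≠ P₃ →
      Module.finrank F (P₁ ⊔ P₂ ⊔ P₃ : Submodule F V) = 3)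
    (hSO : ∀ l ∈ S, ∃! P, P ∈ O ∧ P ≤ l)
    {l : Submodule F V} (hl : l ∈ S) {w : V} (hw : w ∈ W) :
    {v : V | (∃ Q ∈ O, v ∈ Q) ∧ v - w ∈ l}.ncard = 0 ∨
      {v : V | (∃ Q ∈ O, v ∈ Q) ∧ v - w ∈ l}.ncard = Nat.card F := by
  obtain ⟨Q, ⟨hQ, hQl⟩, huniq⟩ := hSO l hl
  by_cases hwl : w ∈ l
  · right
    have : {v : V | (∃ Q ∈ O, v ∈ Q) ∧ v - w ∈ l} = Q := by
      ext v
      simp only [Set.mem_ofPred_eq, SetLike.mem_coe, Submodule.sub_mem_iff_left l hwl]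
      refine ⟨?_, fun hv => ⟨⟨Q, hQ, hv⟩, hQl hv⟩⟩
      rintro ⟨⟨P, hP, hvP⟩, hvl⟩
      by_cases h0 : v = 0
      · exact h0 ▸ zero_mem Q
      · have hspan := Submodule.eq_span_singleton_of_finrank_eq_one (hpt P hP).2 hvP h0
        rw [← huniq P ⟨hP, hspan ▸ (Submodule.span_singleton_le_iff_mem v l).2 hvl⟩]
        exact hvP
    rw [this, Submodule.ncard_coe_eq_pow_finrank, (hpt Q hQ).2, pow_one]
  · rw [ncard_cone_inter_translate (fun P hP => (hpt P hP).2) hwl]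
    set α := l ⊔ Submodule.span F {w} with hα
    have hαW : α ≤ W := sup_le (hline l hl).1 ((Submodule.span_singleton_le_iff_mem w W).2 hw)
    have hw0 : w ≠ 0 := by
      rintro rfl
      exact hwl (zero_mem l)
    have hw1 : Module.finrank F (Submodule.span F {w}) = 1 := finrank_span_singleton hw0
    have hα3 : Module.finrank F α = 3 := by
      rw [hα, Submodule.finrank_sup_of_finrank_eq_one hw1
        (by rwa [Submodule.span_singleton_le_iff_mem]), (hline l hl).2]
    rcases Set.eq_empty_or_nonempty {P ∈ O | P ≤ α ∧ ¬ P ≤ l} with h | ⟨P, hP, hPα, hPl⟩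
    · exact Or.inl (by rw [h, Set.ncard_empty])
    · right
      have hcount := ncard_ovoid_inter_plane_eq (fun P hP => (hpt P hP).2) hcap hW hOcard
        (fun P hP => (hpt P hP).1) (fun β hβW hβ => by
          obtain ⟨m, hm, hmβ⟩ :=
            exists_mem_spread_le_of_finrank_eq_three hW hScard hline hskew hβW hβ
          exact ncard_cap_inter_plane_le (fun P hP => (hpt P hP).2) hcap hβ (hline m hm).2 hmβ
            (hSO m hm))
        hαW hα3 hQ hP (fun h => hPl (h ▸ hQl)) (hQl.trans le_sup_left) hPα
      have hins : {P ∈ O | P ≤ α} = insert Q {P ∈ O | P ≤ α ∧ ¬ P ≤ l} := by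
        ext R
        simp only [Set.mem_ofPred_eq, Set.mem_insert_iff]
        constructor
        · rintro ⟨hR, hRα⟩
          by_cases hRl : R ≤ l
          · exact Or.inl (huniq R ⟨hR, hRl⟩)
          · exact Or.inr ⟨hR, hRα, hRl⟩
        · rintro (rfl | ⟨hR, hRα, -⟩)
          · exact ⟨hQ, hQl.trans le_sup_left⟩
          · exact ⟨hR, hRα⟩
      rw [hins, Set.ncard_insert_of_notMem (fun h => h.2.2 hQl) (Set.toFinite _)] at hcount
      omega

end ProjectiveCounting

section AffinePoints

variable {F V : Type*} [Field F] [AddCommGroup V] [Module F V]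

/-- The points outside a subspace `W` are parametrized injectively by the vectors `v₀ + w`. -/
lemma Submodule.injOn_span_singleton_add {W : Submodule F V} {v₀ : V} (hv₀ : v₀ ∉ W) :
    Set.InjOn (fun w => Submodule.span F {v₀ + w}) W := by
  intro x hx y hy hxy
  obtain ⟨c, hc⟩ := Submodule.mem_span_singleton.1
    ((show Submodule.span F {v₀ + x} = Submodule.span F {v₀ + y} from hxy) ▸
      Submodule.mem_span_singleton_self (v₀ + y))
  have h : (c - 1) • v₀ ∈ W := by
    have h1 : (c - 1) • v₀ = y - c • x := by
      rw [sub_smul, one_smul, sub_eq_sub_iff_add_eq_add, add_comm y, ← hc, smul_add]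
    rw [h1]
    exact W.sub_mem hy (W.smul_mem c hx)
  by_cases h0 : c - 1 = 0
  · rw [sub_eq_zero.1 h0, one_smul] at hc
    exact add_left_cancel hc
  · exact absurd ((W.smul_mem_iff h0).1 h) hv₀

/-- The points outside `W` on the lines joining `v₀` to the points of `O` are those spanned by
`v₀ + w` with `w` on the cone over `O`. -/
lemma setOf_affine_cone_points_eq_image {W : Submodule F V} {v₀ : V} (hv₀ : v₀ ∉ W)
    {O : Set (Submodule F V)} (hO : ∀ Q ∈ O, Q ≤ W) :
    {P : Submodule F V | Module.finrank F P = 1 ∧ ¬ P ≤ W ∧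
      ∃ Q ∈ O, P ≤ Submodule.span F {v₀} ⊔ Q} =
    (fun w => Submodule.span F {v₀ + w}) '' {w | ∃ Q ∈ O, w ∈ Q} := by
  ext P
  constructor
  · rintro ⟨hP, hPW, Q, hQ, hPQ⟩
    obtain ⟨p, hp, hpW⟩ := SetLike.not_le_iff_exists.1 hPW
    obtain ⟨b, hb, x, hx, rfl⟩ := Submodule.mem_sup.1 (hPQ hp)
    obtain ⟨c, rfl⟩ := Submodule.mem_span_singleton.1 hb
    have hc : c ≠ 0 := by
      rintro rfl
      exact hpW (by simpa using hO Q hQ hx)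
    have hmem : v₀ + c⁻¹ • x ∈ P := by
      simpa [smul_add, inv_smul_smul₀ hc] using P.smul_mem c⁻¹ hp
    have hne : v₀ + c⁻¹ • x ≠ 0 := fun h =>
      hv₀ (by rw [eq_neg_of_add_eq_zero_left h]
              exact W.neg_mem (W.smul_mem _ (hO Q hQ hx)))
    have : FiniteDimensional F P := Module.finite_of_finrank_eq_succ hP
    exact ⟨c⁻¹ • x, ⟨Q, hQ, Q.smul_mem _ hx⟩, Submodule.eq_of_le_of_finrank_eq
      ((Submodule.span_singleton_le_iff_mem _ P).2 hmem) (by rw [finrank_span_singleton hne, hP])⟩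
  · rintro ⟨w, ⟨Q, hQ, hw⟩, rfl⟩
    have hnot : v₀ + w ∉ W := fun h => hv₀ ((W.add_mem_iff_left (hO Q hQ hw)).1 h)
    refine ⟨finrank_span_singleton fun h => hnot (h ▸ zero_mem W), ?_, Q, hQ, ?_⟩
    · rwa [Submodule.span_singleton_le_iff_mem]
    · rw [Submodule.span_singleton_le_iff_mem]
      exact Submodule.add_mem_sup (Submodule.mem_span_singleton_self v₀) hw

end AffinePoints


/-- Thas' 1974 construction in the Bruck–Bose model: if S is a regular spread of a
hyperplane W of PG(4,q), O an ovoid of W met by every line of S in exactly one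
point, V₀ a point of PG(4,q) outside W, and K̄ the set of points of PG(4,q)
outside W lying on a line joining V₀ to a point of O, then K̄ has exactly
q³ − q² + q points and every plane of PG(4,q) meeting W in a line of S meets K̄
in either 0 or exactly q points (so K̄ corresponds to a maximal
(q³−q²+q, q)-arc of the plane PG(2,q²) obtained from S via Bruck–Bose). -/
theorem thas_maximal_arc (q : ℕ) (F : Type) [Field F] [Fintype F]
    (hq : Fintype.card F = q)
    (W : Submodule F (Fin 5 → F)) (hW : Module.finrank F W = 4)
    (S : Set (Submodule F (Fin 5 → F))) (hS : IsRegularSpreadIn q W S)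
    (O : Set (Submodule F (Fin 5 → F))) (hO : IsOvoidIn q W O)
    (hSO : ∀ l ∈ S, ∃! P, P ∈ O ∧ P ≤ l)
    (V₀ : Submodule F (Fin 5 → F)) (hV₀ : Module.finrank F V₀ = 1)
    (hV₀W : ¬ V₀ ≤ W) :
    let Kbar : Set (Submodule F (Fin 5 → F)) :=
      {P | Module.finrank F P = 1 ∧ ¬ P ≤ W ∧ ∃ Q ∈ O, P ≤ V₀ ⊔ Q}
    Kbar.ncard = q ^ 3 - q ^ 2 + q ∧
    ∀ π : Submodule F (Fin 5 → F), Module.finrank F π = 3 → π ⊓ W ∈ S →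
      ({P ∈ Kbar | P ≤ π}).ncard = 0 ∨ ({P ∈ Kbar | P ≤ π}).ncard = q := by
  intro Kbar
  obtain ⟨hScard, hline, hskew, -⟩ := hS
  obtain ⟨hOcard, hpt, hcap⟩ := hO
  obtain ⟨v₀, hv₀, hv₀W⟩ := SetLike.not_le_iff_exists.1 hV₀W
  have hspan := Submodule.eq_span_singleton_of_finrank_eq_one hV₀ hv₀
    (fun h => hv₀W (h ▸ zero_mem W))
  have hqF : q = Nat.card F := by rw [← hq, Nat.card_eq_fintype_card]
  have hq1 : 1 < Nat.card F := Finite.one_lt_card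
  subst hspan hqF
  have hK : Kbar = _ := setOf_affine_cone_points_eq_image hv₀W fun Q hQ => (hpt Q hQ).1
  have hcone : {w | ∃ Q ∈ O, w ∈ Q} ⊆ (W : Set (Fin 5 → F)) :=
    fun w ⟨Q, hQ, hw⟩ => (hpt Q hQ).1 hw
  have hinj := Submodule.injOn_span_singleton_add (F := F) hv₀W
  refine ⟨?_, fun π hπ hπS => ?_⟩
  · rw [hK, (hinj.mono hcone).ncard_image, ncard_cone (fun P hP => (hpt P hP).2)
      (Set.nonempty_of_ncard_ne_zero (by omega)), hOcard]
    obtain ⟨r, hr⟩ := Nat.exists_eq_add_of_lt hq1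
    rw [hr, show 1 + r + 1 - 1 = r + 1 by omega]
    have : (1 + r + 1) ^ 3 - (1 + r + 1) ^ 2 = (1 + r + 1) ^ 2 * (r + 1) := by
      rw [Nat.sub_eq_iff_eq_add (Nat.pow_le_pow_right (by omega) (by omega))]
      ring
    rw [this]
    ring
  · have hsup : W ⊔ Submodule.span F {v₀} = ⊤ := by
      refine Submodule.eq_top_of_finrank_eq ?_
      rw [Submodule.finrank_sup_of_finrank_eq_one hV₀ hV₀W, hW, Module.finrank_fin_fun]
    have hπW : ¬ π ≤ W := fun h => by
      have := (hline _ hπS).2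
      rw [inf_eq_left.2 h, hπ] at this
      omega
    obtain ⟨p, hp, hpW⟩ := SetLike.not_le_iff_exists.1 hπW
    obtain ⟨x, hx, b, hb, rfl⟩ := Submodule.mem_sup.1 (hsup ▸ Submodule.mem_top : p ∈ _)
    obtain ⟨c, rfl⟩ := Submodule.mem_span_singleton.1 hb
    have hc : c ≠ 0 := by
      rintro rfl
      exact hpW (by simpa using hx)
    have hw : v₀ + c⁻¹ • x ∈ π := by
      simpa [smul_add, inv_smul_smul₀ hc, add_comm] using π.smul_mem c⁻¹ hp
    have hwW : c⁻¹ • x ∈ W := W.smul_mem _ hx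
    have hsec : {P ∈ Kbar | P ≤ π} = (fun w => Submodule.span F {v₀ + w}) ''
        {v | (∃ Q ∈ O, v ∈ Q) ∧ v - c⁻¹ • x ∈ π ⊓ W} := by
      rw [hK]
      have hiff : ∀ v ∈ W, (v - c⁻¹ • x ∈ π ⊓ W ↔ Submodule.span F {v₀ + v} ≤ π) := fun v hv => by
        rw [Submodule.mem_inf, and_iff_left (W.sub_mem hv hwW),
          Submodule.span_singleton_le_iff_mem, ← add_sub_add_left_eq_sub v (c⁻¹ • x) v₀,
          Submodule.sub_mem_iff_left π hw]
      ext P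
      constructor
      · rintro ⟨⟨v, hv, rfl⟩, hP⟩
        exact ⟨v, ⟨hv, (hiff v (hcone hv)).2 hP⟩, rfl⟩
      · rintro ⟨v, ⟨hv, hvπ⟩, rfl⟩
        exact ⟨⟨v, hv, rfl⟩, (hiff v (hcone hv)).1 hvπ⟩
    rw [hsec, (hinj.mono fun v hv => hcone hv.1).ncard_image]
    exact ncard_ovoid_cone_inter_translate hW hScard hline hskew hOcard hpt hcap hSO hπS hwW
end

section
/- Let S be a regular spread of PG(3,q). Then there exists a 2-dimensional GF(q^2)-subspace L of GF(q^2)^4 containing no point of PG(3,q) (that is, no nonzero vector of L is a GF(q^2)-scalar multiple of a vector all of whose coordinates lie in GF(q)) such that S = { span_{GF(q^2)}{P, σ(P)} ∩ GF(q)^4 : P ∈ L, P ≠ 0 }, where σ is the coordinatewise Frobenius map x ↦ x^q on GF(q^2)^4 and the intersection with GF(q)^4 is viewed as a 2-dimensional GF(q)-subspace, i.e., every line of S has the form P P^q for some point P of the line L of PG(3,q^2). -/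
/-- A spread is regular (Desarguesian) if for any three distinct lines of the
spread, the regulus containing them is contained in the spread. -/
def IsRegularSpread (q : ℕ) {F : Type*} [Field F]
    (S : Set (Submodule F (Fin 4 → F))) : Prop :=
  IsSpread q S ∧
  ∀ l₁ ∈ S, ∀ l₂ ∈ S, ∀ l₃ ∈ S, l₁ ≠ l₂ → l₁ ≠ l₃ → l₂ ≠ l₃ →
    ∀ R : Set (Submodule F (Fin 4 → F)),
      IsRegulus q R → l₁ ∈ R → l₂ ∈ R → l₃ ∈ R → R ⊆ S

/-- The coordinatewise Frobenius map x ↦ x^q on GF(q²)^4. -/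
def frobVec (q : ℕ) {K : Type*} [Field K] (v : Fin 4 → K) : Fin 4 → K :=
  fun i => (v i) ^ q

/-- The natural GF(q)-linear embedding GF(q)^4 → GF(q²)^4. -/
def embVec (F K : Type*) [Field F] [Field K] [Algebra F K] :
    (Fin 4 → F) →ₗ[F] (Fin 4 → K) :=
  LinearMap.pi fun i => (Algebra.linearMap F K).comp (LinearMap.proj i)


theorem exists_linear_span_of_affine {F U : Type*} [Field F] [AddCommGroup U] [Module F U]
    (hU : Module.finrank F U = 2) (C : Set (U →ₗ[F] U)) (h0 : 0 ∈ C) (h1 : LinearMap.id ∈ C)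
    (hinj : ∀ A ∈ C, ∀ B ∈ C, ∀ x, x ≠ 0 → A x = B x → A = B)
    (htrans : ∀ x, x ≠ 0 → ∀ y, ∃ A ∈ C, A x = y)
    (haff : ∀ A ∈ C, ∀ B ∈ C, ∀ t : F, A + t • (B - A) ∈ C) :
    ∃ T : U →ₗ[F] U, (∀ (a : F) x, T x = a • x → x = 0) ∧
      (∃ c d : F, ∀ x, T (T x) = c • x + d • T x) ∧
      ∀ A ∈ C, ∃ a b : F, A = a • LinearMap.id + b • T := by
  have hsmul : ∀ A ∈ C, ∀ t : F, t • A ∈ C := fun A hA t => by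
    simpa using haff 0 h0 A hA t
  have hfd : FiniteDimensional F U := Module.finite_of_finrank_eq_succ hU
  let bas := Module.finBasisOfFinrankEq F U hU
  set x := bas 0 with hx
  set y := bas 1 with hy
  have hli : LinearIndependent F ![x, y] := by
    have := bas.linearIndependent
    convert this using 1
    ext i; fin_cases i <;> rfl
  rw [LinearIndependent.pair_iff] at hli
  have hspan : ∀ z : U, ∃ a b : F, z = a • x + b • y := fun z =>
    ⟨bas.repr z 0, bas.repr z 1, by
      have := bas.sum_repr z
      rw [Fin.sum_univ_two] at this
      exact this.symm⟩
  have hx0 : x ≠ 0 := bas.ne_zero 0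
  have hy0 : y ≠ 0 := bas.ne_zero 1
  obtain ⟨T, hT, hTx⟩ := htrans x hx0 y
  have hTs : ∀ a : F, T ≠ a • LinearMap.id := by
    intro a h
    have := hli a (-1) (by rw [← hTx, h]; simp)
    simp at this
  have hTe : ∀ (a : F) z, T z = a • z → z = 0 := by
    intro a z hz
    by_contra hne
    exact hTs a (hinj T hT _ (hsmul _ h1 a) z hne (by simpa using hz))
  have hlin : ∀ a b : F, a • LinearMap.id + b • T ∈ C := by
    intro a b
    by_cases hF : ∃ t : F, t ≠ 0 ∧ t ≠ 1
    · obtain ⟨t, ht0, ht1⟩ := hF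
      have ht1' : 1 - t ≠ 0 := sub_ne_zero.2 ht1.symm
      have := haff _ (hsmul _ h1 ((1 - t)⁻¹ * a)) _ (hsmul _ hT (t⁻¹ * b)) t
      convert this using 1
      ext z
      simp only [LinearMap.add_apply, LinearMap.smul_apply, LinearMap.sub_apply, LinearMap.id_apply]
      match_scalars <;> field_simp
      ring
    · push Not at hF
      have hF' : ∀ t : F, t = 0 ∨ t = 1 := fun t => by
        by_cases h : t = 0
        · exact Or.inl h
        · exact Or.inr (hF t h)
      have h2 : (1 : F) + 1 = 0 := by
        rcases hF' (1 + 1) with h | h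
        · exact h
        · simp at h
      have h2U : ∀ z : U, z + z = 0 := fun z => by
        have : ((1 : F) + 1) • z = 0 := by rw [h2, zero_smul]
        simpa [add_smul] using this
      have hcase : ∀ z : U, z = 0 ∨ z = x ∨ z = y ∨ z = x + y := by
        intro z
        obtain ⟨c, d, rfl⟩ := hspan z
        rcases hF' c with rfl | rfl <;> rcases hF' d with rfl | rfl <;> simp
      obtain ⟨B, hB, hBx⟩ := htrans x hx0 (x + y)
      have hBne : B ≠ LinearMap.id := by
        rintro rfl
        simp at hBx
        exact hy0 hBx
      have hBfix : ∀ z, B z = z → z = 0 := by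
        intro z hz
        by_contra hne
        exact hBne (hinj B hB _ h1 z hne (by simpa using hz))
      have hTfix : ∀ z, T z = z → z = 0 := fun z hz => hTe 1 z (by simpa using hz)
      have hxy : x + y ≠ 0 := by
        intro h
        have := hli 1 1 (by simpa using h)
        simp at this
      have hTker : ∀ z, T z = 0 → z = 0 := fun z hz => hTe 0 z (by simpa using hz)
      have hTy : T y = x + y := by
        rcases hcase (T y) with h | h | h | h
        · exact absurd (hTker y h) hy0
        · exact absurd (hTfix (x + y) (by rw [map_add, hTx, h, add_comm])) hxy
        · exact absurd (hTfix y h) hy0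
        · exact h
      have hBne0 : B ≠ 0 := by
        rintro rfl
        exact hxy (by simpa using hBx.symm)
      have hBy : B y = x := by
        rcases hcase (B y) with h | h | h | h
        · exact absurd (hinj B hB 0 h0 y hy0 (by simpa using h)) hBne0
        · exact h
        · exact absurd (hBfix y h) hy0
        · refine absurd (hinj B hB 0 h0 (x + y) hxy ?_) hBne0
          rw [map_add, hBx, h, h2U, LinearMap.zero_apply]
      have hBT : B = LinearMap.id + T := by
        refine bas.ext fun i => ?_
        fin_cases i
        · change B x = x + T x
          rw [hBx, hTx]
        · change B y = y + T y
          rw [hBy, hTy, add_left_comm, h2U, add_zero]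
      rcases hF' a with rfl | rfl <;> rcases hF' b with rfl | rfl <;> simp [h0, h1, hT, ← hBT, hB]
  obtain ⟨c, d, hcd⟩ := hspan (T y)
  have hquad : ∀ z, T (T z) = c • z + d • T z := by
    intro z
    obtain ⟨a, b, rfl⟩ := hspan z
    simp only [map_add, map_smul, hTx, hcd]
    module
  refine ⟨T, hTe, ⟨c, d, hquad⟩, fun A hA => ?_⟩
  obtain ⟨a, b, hab⟩ := hspan (A x)
  exact ⟨a, b, hinj A hA _ (hlin a b) x hx0 (by simp [hab, hTx])⟩

theorem exists_eq_smul_add_smul {F V : Type*} [Field F] [AddCommGroup V] [Module F V]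
    {m : Submodule F V} (hm : Module.finrank F m = 2) {v w : V} (hv : v ∈ m) (hw : w ∈ m)
    (h : ∀ a b : F, a • v + b • w = 0 → a = 0 ∧ b = 0) {z : V} (hz : z ∈ m) :
    ∃ a b : F, a • v + b • w = z := by
  have hfd : FiniteDimensional F m := Module.finite_of_finrank_eq_succ hm
  have hli : LinearIndependent F ![v, w] := LinearIndependent.pair_iff.2 h
  have hle : Submodule.span F {v, w} ≤ m := by
    rw [Submodule.span_le]
    rintro _ (rfl | rfl)
    exacts [hv, hw]
  have heq : Submodule.span F {v, w} = m := by
    refine Submodule.eq_of_le_of_finrank_eq hle ?_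
    have := finrank_span_eq_card hli
    rw [Matrix.range_cons_cons_empty, Fintype.card_fin] at this
    exact this.trans hm.symm
  rw [← heq, Submodule.mem_span_pair] at hz
  exact hz

/-- Homogeneous coordinates of the points of the projective line over `F`. -/
def projCoord {F : Type*} [Field F] : Option F → F × F
  | none => (0, 1)
  | some t => (1, t)

theorem projCoord_det_ne_zero {F : Type*} [Field F] {o p : Option F} (h : o ≠ p) :
    (projCoord o).1 * (projCoord p).2 - (projCoord o).2 * (projCoord p).1 ≠ 0 := by
  rcases o with _ | a <;> rcases p with _ | b
  · exact absurd rfl h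
  · simp [projCoord]
  · simp [projCoord]
  · simp only [projCoord, one_mul, mul_one]
    intro h'
    exact h (by rw [sub_eq_zero.1 h'])

/-- The image under `ψ` of the vectors `(s • x, t • x)`, where `(s, t)` are the coordinates
of `o`. -/
def rulingLine {F U V : Type*} [Field F] [AddCommGroup U] [Module F U] [AddCommGroup V]
    [Module F V] (ψ : (U × U) ≃ₗ[F] V) (o : Option F) : Submodule F V :=
  LinearMap.range (ψ.toLinearMap ∘ₗ
    LinearMap.prod ((projCoord o).1 • LinearMap.id) ((projCoord o).2 • LinearMap.id))

section Ruling

variable {F U V : Type*} [Field F] [AddCommGroup U] [Module F U] [AddCommGroup V] [Module F V]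

theorem mem_rulingLine {ψ : (U × U) ≃ₗ[F] V} {o : Option F} {v : V} :
    v ∈ rulingLine ψ o ↔ ∃ x, ψ ((projCoord o).1 • x, (projCoord o).2 • x) = v := by
  simp [rulingLine]

theorem finrank_rulingLine (ψ : (U × U) ≃ₗ[F] V) (o : Option F) :
    Module.finrank F (rulingLine ψ o) = Module.finrank F U := by
  apply LinearMap.finrank_range_of_inj
  intro x y h
  have h' := ψ.injective h
  rcases o with _ | a
  · simpa [projCoord] using h'
  · have := congrArg Prod.fst h'
    simpa [projCoord] using this

theorem rulingLine_inf_eq_bot (ψ : (U × U) ≃ₗ[F] V) {o p : Option F} (h : o ≠ p) :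
    rulingLine ψ o ⊓ rulingLine ψ p = ⊥ := by
  rw [Submodule.eq_bot_iff]
  rintro v ⟨hv, hw⟩
  obtain ⟨x, rfl⟩ := mem_rulingLine.1 hv
  obtain ⟨y, hy⟩ := mem_rulingLine.1 hw
  have h' := ψ.injective hy
  have h1 := congrArg Prod.fst h'
  have h2 := congrArg Prod.snd h'
  simp only at h1 h2
  have h3 : ((projCoord o).1 * (projCoord p).2 - (projCoord o).2 * (projCoord p).1) • x = 0 := by
    have : ((projCoord o).1 * (projCoord p).2 - (projCoord o).2 * (projCoord p).1) • x =
      (projCoord p).2 • ((projCoord o).1 • x) - (projCoord p).1 • ((projCoord o).2 • x) := by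
      module
    rw [this, ← h1, ← h2]
    module
  rw [(smul_eq_zero.1 h3).resolve_left (projCoord_det_ne_zero h)]
  simp

theorem rulingLine_injective [Nontrivial U] (ψ : (U × U) ≃ₗ[F] V) :
    Function.Injective (rulingLine ψ) := by
  intro o p h
  by_contra hne
  have h1 := rulingLine_inf_eq_bot ψ hne
  rw [← h, inf_idem] at h1
  obtain ⟨x, hx⟩ := exists_ne (0 : U)
  have : ψ ((projCoord o).1 • x, (projCoord o).2 • x) ∈ rulingLine ψ o := mem_rulingLine.2 ⟨x, rfl⟩
  rw [h1, Submodule.mem_bot, LinearEquiv.map_eq_zero_iff] at this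
  rcases o with _ | a <;> simp [projCoord, hx] at this

theorem exists_mem_of_meets_rulingLine {ψ : (U × U) ≃ₗ[F] V} {m : Submodule F V} {o : Option F}
    (h : m ⊓ rulingLine ψ o ≠ ⊥) :
    ∃ x, x ≠ 0 ∧ ψ ((projCoord o).1 • x, (projCoord o).2 • x) ∈ m := by
  obtain ⟨v, ⟨hvm, hv⟩, hv0⟩ := Submodule.exists_mem_ne_zero_of_ne_bot h
  obtain ⟨x, rfl⟩ := mem_rulingLine.1 hv
  refine ⟨x, ?_, hvm⟩
  rintro rfl
  simp at hv0

theorem meets_rulingLine (ψ : (U × U) ≃ₗ[F] V) {m : Submodule F V} (hm : Module.finrank F m = 2)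
    {o₁ o₂ o₃ : Option F} (h12 : o₁ ≠ o₂) (h13 : o₁ ≠ o₃) (h23 : o₂ ≠ o₃)
    (h1 : m ⊓ rulingLine ψ o₁ ≠ ⊥) (h2 : m ⊓ rulingLine ψ o₂ ≠ ⊥)
    (h3 : m ⊓ rulingLine ψ o₃ ≠ ⊥) (o : Option F) : m ⊓ rulingLine ψ o ≠ ⊥ := by
  obtain ⟨x₁, hx₁, hm₁⟩ := exists_mem_of_meets_rulingLine h1
  obtain ⟨x₂, hx₂, hm₂⟩ := exists_mem_of_meets_rulingLine h2
  obtain ⟨x₃, hx₃, hm₃⟩ := exists_mem_of_meets_rulingLine h3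
  have d12 := projCoord_det_ne_zero h12
  have d13 := projCoord_det_ne_zero h13
  have d23 := projCoord_det_ne_zero h23
  have hc : (projCoord o).1 ≠ 0 ∨ (projCoord o).2 ≠ 0 := by
    rcases o with _ | a <;> simp [projCoord]
  have hmem : ∀ x, ψ ((projCoord o).1 • x, (projCoord o).2 • x) ∈ rulingLine ψ o :=
    fun x => mem_rulingLine.2 ⟨x, rfl⟩
  generalize projCoord o₁ = p₁ at *
  generalize projCoord o₂ = p₂ at *
  generalize projCoord o₃ = p₃ at *
  generalize projCoord o = p at *
  obtain ⟨s₁, t₁⟩ := p₁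
  obtain ⟨s₂, t₂⟩ := p₂
  obtain ⟨s₃, t₃⟩ := p₃
  obtain ⟨s, t⟩ := p
  dsimp only at *
  obtain ⟨α, β, hαβ⟩ := exists_eq_smul_add_smul hm hm₁ hm₂ (by
    intro a b hab
    rw [← map_smul, ← map_smul, ← map_add, LinearEquiv.map_eq_zero_iff, Prod.mk_eq_zero] at hab
    obtain ⟨e1, e2⟩ := hab
    simp only [Prod.smul_mk, Prod.mk_add_mk] at e1 e2
    have ea : (a * (s₁ * t₂ - t₁ * s₂)) • x₁ = 0 := by
      have : (a * (s₁ * t₂ - t₁ * s₂)) • x₁ = t₂ • (a • s₁ • x₁ + b • s₂ • x₂) -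
        s₂ • (a • t₁ • x₁ + b • t₂ • x₂) := by module
      rw [this, e1, e2]; simp
    have eb : (b * (s₁ * t₂ - t₁ * s₂)) • x₂ = 0 := by
      have : (b * (s₁ * t₂ - t₁ * s₂)) • x₂ = s₁ • (a • t₁ • x₁ + b • t₂ • x₂) -
        t₁ • (a • s₁ • x₁ + b • s₂ • x₂) := by module
      rw [this, e1, e2]; simp
    simp [hx₁, hx₂, d12] at ea eb
    exact ⟨ea, eb⟩) hm₃
  rw [← map_smul, ← map_smul, ← map_add] at hαβ
  have hαβ' := ψ.injective hαβ
  have e1 := congrArg Prod.fst hαβ'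
  have e2 := congrArg Prod.snd hαβ'
  simp only [Prod.smul_mk, Prod.mk_add_mk] at e1 e2
  have key : (α * (s₁ * t₃ - t₁ * s₃)) • x₁ + (β * (s₂ * t₃ - t₂ * s₃)) • x₂ = 0 := by
    have : (α * (s₁ * t₃ - t₁ * s₃)) • x₁ + (β * (s₂ * t₃ - t₂ * s₃)) • x₂ =
      t₃ • (α • s₁ • x₁ + β • s₂ • x₂) - s₃ • (α • t₁ • x₁ + β • t₂ • x₂) := by module
    rw [this, e1, e2]
    module
  have hβ : β ≠ 0 := by
    rintro rfl
    have hα : α = 0 := by simpa [d13, hx₁] using key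
    subst hα
    simp only [zero_smul, add_zero] at e1 e2
    have e1' := (smul_eq_zero.1 e1.symm).resolve_right hx₃
    have e2' := (smul_eq_zero.1 e2.symm).resolve_right hx₃
    simp [e1', e2'] at d13
  obtain ⟨c, hc12⟩ : ∃ c : F, x₂ = c • x₁ := by
    refine ⟨-(β * (s₂ * t₃ - t₂ * s₃))⁻¹ * (α * (s₁ * t₃ - t₁ * s₃)), ?_⟩
    have hd := mul_ne_zero hβ d23
    have e := eq_neg_of_add_eq_zero_right key
    rw [← inv_smul_smul₀ hd x₂, e]
    module
  have hc0 : c ≠ 0 := by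
    rintro rfl
    simp [hc12] at hx₂
  rw [Ne, Submodule.eq_bot_iff]
  intro hbot
  have hin : ψ (s • x₁, t • x₁) ∈ m := by
    have : (s • x₁, t • x₁) = ((s * t₂ - t * s₂) / (s₁ * t₂ - t₁ * s₂)) • (s₁ • x₁, t₁ • x₁) +
        ((s₁ * t - t₁ * s) / (s₁ * t₂ - t₁ * s₂) * c⁻¹) • (s₂ • x₂, t₂ • x₂) := by
      rw [hc12]
      obtain ⟨d, hd⟩ : ∃ d, d = s₁ * t₂ - t₁ * s₂ := ⟨_, rfl⟩
      rw [← hd] at d12 ⊢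
      ext
      · simp only [Prod.smul_mk, Prod.mk_add_mk]
        match_scalars
        field_simp
        rw [hd]
        ring
      · simp only [Prod.smul_mk, Prod.mk_add_mk]
        match_scalars
        field_simp
        rw [hd]
        ring
    rw [this, map_add, map_smul, map_smul]
    exact m.add_mem (m.smul_mem _ hm₁) (m.smul_mem _ hm₂)
  have := hbot _ ⟨hin, hmem x₁⟩
  rw [LinearEquiv.map_eq_zero_iff, Prod.mk_eq_zero] at this
  simp [hx₁] at this
  tauto

end Ruling

theorem isRegulus_range_rulingLine {F U : Type*} [Field F] [Fintype F] [AddCommGroup U]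
    [Module F U] (hU : Module.finrank F U = 2) (ψ : (U × U) ≃ₗ[F] (Fin 4 → F)) :
    IsRegulus (Fintype.card F) (Set.range (rulingLine ψ)) := by
  have : Nontrivial U := Module.nontrivial_of_finrank_pos (R := F) (by omega)
  refine ⟨?_, ?_, ?_, ?_⟩
  · rw [← Set.image_univ, Set.ncard_image_of_injective _ (rulingLine_injective ψ),
      Set.ncard_univ]
    simp
  · rintro _ ⟨o, rfl⟩
    exact (finrank_rulingLine ψ o).trans hU
  · rintro _ ⟨o, rfl⟩ _ ⟨p, rfl⟩ h
    exact rulingLine_inf_eq_bot ψ fun h' => h (by rw [h'])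
  · rintro m hm ⟨_, ⟨o₁, rfl⟩, _, ⟨o₂, rfl⟩, _, ⟨o₃, rfl⟩, h12, h13, h23, h1, h2, h3⟩ _ ⟨o, rfl⟩
    exact meets_rulingLine ψ hm (ne_of_apply_ne _ h12) (ne_of_apply_ne _ h13)
      (ne_of_apply_ne _ h23) h1 h2 h3 o

theorem natCard_ne_zero_eq {F W : Type*} [Field F] [Fintype F] [AddCommGroup W] [Module F W]
    [FiniteDimensional F W] :
    Nat.card {w : W // w ≠ 0} = Fintype.card F ^ Module.finrank F W - 1 := by
  classical
  have : Finite W := Module.finite_of_finite F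
  have := Fintype.ofFinite W
  rw [Nat.card_eq_fintype_card, Fintype.card_subtype_compl, Fintype.card_subtype_eq,
    Module.card_eq_pow_finrank (K := F)]

theorem IsSpread.exists_mem {F : Type*} [Field F] [Fintype F] {q : ℕ} (hF : Fintype.card F = q)
    {S : Set (Submodule F (Fin 4 → F))} (hS : IsSpread q S) {v : Fin 4 → F} (hv : v ≠ 0) :
    ∃ l ∈ S, v ∈ l := by
  obtain ⟨hcard, hline, hskew⟩ := hS
  have hfin : S.Finite := Set.finite_of_ncard_ne_zero (by omega)
  have : Fintype S := hfin.fintype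
  let f : (Σ l : S, {w : l.1 // w ≠ 0}) → {w : Fin 4 → F // w ≠ 0} :=
    fun p => ⟨p.2.1.1, fun h => p.2.2 (Subtype.ext h)⟩
  have hf : Function.Injective f := by
    rintro ⟨⟨l, hl⟩, ⟨⟨x, hx⟩, hx0⟩⟩ ⟨⟨m, hm⟩, ⟨⟨y, hy⟩, hy0⟩⟩ h
    have hxy : x = y := congrArg Subtype.val h
    subst hxy
    have hlm : l = m := by
      by_contra hne
      have := hskew l hl m hm hne
      have hx' : x ∈ l ⊓ m := ⟨hx, hy⟩
      rw [this, Submodule.mem_bot] at hx'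
      exact hx0 (Subtype.ext hx')
    subst hlm
    rfl
  have hbij := hf.bijective_of_nat_card_le (by
    rw [Nat.card_sigma, natCard_ne_zero_eq (F := F)]
    have : ∀ l : S, Nat.card {w : l.1 // w ≠ 0} = q ^ 2 - 1 := fun l => by
      rw [natCard_ne_zero_eq (F := F), hline l.1 l.2, hF]
    simp only [this, Finset.sum_const, Finset.card_univ, smul_eq_mul, hF, Module.finrank_fin_fun]
    rw [← Nat.card_eq_fintype_card, Nat.card_coe_set_eq, hcard, ← Nat.sq_sub_sq (q ^ 2) 1]
    apply le_of_eq
    ring_nf)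
  obtain ⟨⟨l, w⟩, hw⟩ := hbij.2 ⟨v, hv⟩
  refine ⟨l.1, l.2, ?_⟩
  have : w.1.1 = v := congrArg Subtype.val hw
  exact this ▸ w.1.2

theorem isCompl_of_isLine {F : Type*} [Field F] {l m : Submodule F (Fin 4 → F)} (hl : IsLine F l)
    (hm : IsLine F m) (h : l ⊓ m = ⊥) : IsCompl l m := by
  refine ⟨disjoint_iff.2 h, codisjoint_iff.2 (Submodule.eq_top_of_finrank_eq ?_)⟩
  have := Submodule.finrank_sup_add_finrank_inf_eq l m
  rw [h, finrank_bot, hl, hm] at this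
  simpa using this

section Coordinates

variable {F U : Type*} [Field F] [AddCommGroup U] [Module F U]

theorem rulingLine_eq_of_le (hU : Module.finrank F U = 2) {ψ : (U × U) ≃ₗ[F] (Fin 4 → F)}
    {o : Option F} {l : Submodule F (Fin 4 → F)} (hl : IsLine F l)
    (h : ∀ x, ψ ((projCoord o).1 • x, (projCoord o).2 • x) ∈ l) : rulingLine ψ o = l := by
  refine Submodule.eq_of_le_of_finrank_eq ?_ (((finrank_rulingLine ψ o).trans hU).trans hl.symm)
  intro v hv
  obtain ⟨x, rfl⟩ := mem_rulingLine.1 hv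
  exact h x

theorem exists_coordinates_s13 {l₀ l₁ l : Submodule F (Fin 4 → F)} (h₀ : IsLine F l₀)
    (h₁ : IsLine F l₁) (h : IsLine F l) (h01 : l₁ ⊓ l₀ = ⊥) (hl0 : l₀ ⊓ l = ⊥)
    (hl1 : l₁ ⊓ l = ⊥) :
    ∃ φ : (l₁ × l₁) ≃ₗ[F] (Fin 4 → F),
      rulingLine φ none = l ∧ rulingLine φ (some 0) = l₀ ∧ rulingLine φ (some 1) = l₁ := by
  have hc := isCompl_of_isLine h₀ h hl0
  let e₀ : l₁ ≃ₗ[F] l₀ := LinearEquiv.ofInjectiveOfFinrankEq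
    (l₀.projectionOnto l hc ∘ₗ l₁.subtype) (by
      rw [← LinearMap.ker_eq_bot, Submodule.eq_bot_iff]
      rintro ⟨x, hx⟩ hx'
      have : x ∈ l := (Submodule.projectionOnto_apply_eq_zero_iff hc).1 hx'
      have hx2 : x ∈ l₁ ⊓ l := ⟨hx, this⟩
      rw [hl1, Submodule.mem_bot] at hx2
      exact Subtype.ext hx2) (h₁.trans h₀.symm)
  let e : l₁ ≃ₗ[F] l := LinearEquiv.ofInjectiveOfFinrankEq
    (l.projectionOnto l₀ hc.symm ∘ₗ l₁.subtype) (by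
      rw [← LinearMap.ker_eq_bot, Submodule.eq_bot_iff]
      rintro ⟨x, hx⟩ hx'
      have : x ∈ l₀ := (Submodule.projectionOnto_apply_eq_zero_iff hc.symm).1 hx'
      have hx2 : x ∈ l₁ ⊓ l₀ := ⟨hx, this⟩
      rw [h01, Submodule.mem_bot] at hx2
      exact Subtype.ext hx2) (h₁.trans h.symm)
  let φ := (e₀.prodCongr e).trans (Submodule.prodEquivOfIsCompl l₀ l hc)
  have hφ : ∀ x y, φ (x, y) = (e₀ x : Fin 4 → F) + e y := fun x y => rfl
  refine ⟨φ, rulingLine_eq_of_le h₁ h fun x => ?_, rulingLine_eq_of_le h₁ h₀ fun x => ?_,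
    rulingLine_eq_of_le h₁ h₁ fun x => ?_⟩
  · simp [projCoord, hφ]
  · simp [projCoord, hφ]
  · have : (e₀ x : Fin 4 → F) + e x = x :=
      Submodule.projection_add_projection_eq_self hc (x : Fin 4 → F)
    simp [projCoord, hφ, this]

theorem apply_mem_map_graph {V : Type*} [AddCommGroup V] [Module F V] (φ : (U × U) ≃ₗ[F] V)
    (A : U →ₗ[F] U) {x y : U} : φ (x, y) ∈ A.graph.map φ.toLinearMap ↔ y = A x := by
  refine (Submodule.mem_map_equiv (e := φ) (p := A.graph)).trans ?_
  simp [LinearMap.mem_graph_iff]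

theorem exists_eq_map_graph (hU : Module.finrank F U = 2) (φ : (U × U) ≃ₗ[F] (Fin 4 → F))
    {l : Submodule F (Fin 4 → F)} (hl : IsLine F l) (h : l ⊓ rulingLine φ none = ⊥) :
    ∃ A : U →ₗ[F] U, l = A.graph.map φ.toLinearMap := by
  have hfd : FiniteDimensional F U := Module.finite_of_finrank_eq_succ hU
  let G := l.comap φ.toLinearMap
  have hG : Module.finrank F G = 2 := by
    rw [← hl]
    exact (φ.submoduleMap G).finrank_eq.trans (by
      rw [show G.map φ.toLinearMap = l from Submodule.map_comap_eq_of_surjective φ.surjective l])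
  let f : G →ₗ[F] U := LinearMap.fst F U U ∘ₗ G.subtype
  have hf : Function.Injective f := by
    rw [← LinearMap.ker_eq_bot, Submodule.eq_bot_iff]
    rintro ⟨⟨x, y⟩, hx⟩ hx'
    obtain rfl : x = 0 := hx'
    have h1 : φ (0, y) ∈ l ⊓ rulingLine φ none :=
      ⟨hx, mem_rulingLine.2 ⟨y, by simp [projCoord]⟩⟩
    rw [h, Submodule.mem_bot, LinearEquiv.map_eq_zero_iff] at h1
    exact Subtype.ext h1
  obtain ⟨A, hA⟩ := Submodule.exists_eq_graph (G := G)
    ⟨hf, (LinearMap.injective_iff_surjective_of_finrank_eq_finrank (hG.trans hU.symm)).1 hf⟩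
  exact ⟨A, by rw [← hA]; exact (Submodule.map_comap_eq_of_surjective φ.surjective l).symm⟩

theorem rulingLine_some (φ : (U × U) ≃ₗ[F] (Fin 4 → F)) (t : F) :
    rulingLine φ (some t) = (t • LinearMap.id : U →ₗ[F] U).graph.map φ.toLinearMap := by
  ext v
  obtain ⟨⟨x, y⟩, rfl⟩ := φ.surjective v
  rw [apply_mem_map_graph, mem_rulingLine]
  simp [projCoord, eq_comm]

/-- The coordinate system sending `(x, y)` to the point with coordinates `(x, A x + D y)`. -/
theorem exists_shear (hU : Module.finrank F U = 2) (φ : (U × U) ≃ₗ[F] (Fin 4 → F))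
    (A D : U →ₗ[F] U) (hD : ∀ x, D x = 0 → x = 0) :
    ∃ ψ : (U × U) ≃ₗ[F] (Fin 4 → F), ∀ x y, ψ (x, y) = φ (x, A x + D y) := by
  have hfd : FiniteDimensional F U := Module.finite_of_finrank_eq_succ hU
  let g : (U × U) →ₗ[F] (U × U) :=
    (LinearMap.fst F U U).prod (A ∘ₗ LinearMap.fst F U U + D ∘ₗ LinearMap.snd F U U)
  have hg : Function.Injective g := by
    rw [← LinearMap.ker_eq_bot, Submodule.eq_bot_iff]
    rintro ⟨x, y⟩ h
    have h' : (x, A x + D y) = (0 : U × U) := h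
    obtain ⟨rfl, h2⟩ := Prod.mk_eq_zero.1 h'
    rw [map_zero, zero_add] at h2
    rw [hD y h2]
    rfl
  exact ⟨(LinearEquiv.ofInjectiveEndo g hg).trans φ, fun x y => rfl⟩

end Coordinates

theorem IsRegularSpread.add_smul_sub_mem {F U : Type*} [Field F] [Fintype F] [AddCommGroup U]
    [Module F U] {q : ℕ} (hF : Fintype.card F = q) {S : Set (Submodule F (Fin 4 → F))}
    (hS : IsRegularSpread q S) (hU : Module.finrank F U = 2) {φ : (U × U) ≃ₗ[F] (Fin 4 → F)}
    (hφ : rulingLine φ none ∈ S) {A B : U →ₗ[F] U} (hA : A.graph.map φ.toLinearMap ∈ S)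
    (hB : B.graph.map φ.toLinearMap ∈ S) (hAB : ∀ x, A x = B x → x = 0) (t : F) :
    (A + t • (B - A)).graph.map φ.toLinearMap ∈ S := by
  have : Nontrivial U := Module.nontrivial_of_finrank_pos (R := F) (by omega)
  obtain ⟨⟨hcard, hline, hskew⟩, hreg⟩ := hS
  obtain ⟨ψ, hψ⟩ := exists_shear hU φ A (B - A) (fun x hx => hAB x (by
    rw [LinearMap.sub_apply, sub_eq_zero] at hx
    exact hx.symm))
  have hnone : rulingLine ψ none = rulingLine φ none :=
    rulingLine_eq_of_le hU (hline _ hφ) fun x => by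
      rw [hψ]
      exact mem_rulingLine.2 ⟨(B - A) x, by simp [projCoord]⟩
  have hsome : ∀ t, rulingLine ψ (some t) = (A + t • (B - A)).graph.map φ.toLinearMap := fun t => by
    ext v
    obtain ⟨⟨x, y⟩, rfl⟩ := φ.surjective v
    rw [apply_mem_map_graph, mem_rulingLine]
    simp [projCoord, hψ, eq_comm]
  rw [← hsome]
  have hinj := rulingLine_injective ψ
  refine hreg (rulingLine ψ none) (hnone ▸ hφ) (rulingLine ψ (some 0)) ?_
    (rulingLine ψ (some 1)) ?_ (hinj.ne (by simp)) (hinj.ne (by simp)) (hinj.ne (by simp))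
    (Set.range (rulingLine ψ)) (hF ▸ isRegulus_range_rulingLine hU ψ) ⟨_, rfl⟩ ⟨_, rfl⟩ ⟨_, rfl⟩
    ⟨_, rfl⟩
  · rw [hsome]
    simpa using hA
  · rw [hsome]
    simpa using hB

/-- The lines of a regular spread are invariant under an endomorphism without eigenvectors. -/
theorem IsRegularSpread.exists_invariant {F : Type*} [Field F] [Fintype F] {q : ℕ}
    (hF : Fintype.card F = q) {S : Set (Submodule F (Fin 4 → F))} (hS : IsRegularSpread q S) :
    ∃ T : (Fin 4 → F) →ₗ[F] (Fin 4 → F), (∀ (a : F) v, T v = a • v → v = 0) ∧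
      (∃ c d : F, ∀ v, T (T v) = c • v + d • T v) ∧ ∀ l ∈ S, ∀ v ∈ l, T v ∈ l := by
  have hspread := hS.1
  obtain ⟨hcard, hline, hskew⟩ := hS.1
  have hq : 2 ≤ q := hF ▸ Fintype.one_lt_card
  have hfin : S.Finite := Set.finite_of_ncard_ne_zero (by omega)
  obtain ⟨l, l₀, l₁, hl, hl₀, hl₁, hne0, hne1, hne01⟩ :=
    (Set.two_lt_ncard_iff hfin).1 (by rw [hcard]; nlinarith)
  obtain ⟨φ, hφ, hφ0, hφ1⟩ := exists_coordinates_s13 (hline _ hl₀) (hline _ hl₁) (hline _ hl)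
    (hskew _ hl₁ _ hl₀ hne01.symm) (hskew _ hl₀ _ hl hne0.symm) (hskew _ hl₁ _ hl hne1.symm)
  have hU : Module.finrank F l₁ = 2 := hline _ hl₁
  have hφS : rulingLine φ none ∈ S := hφ ▸ hl
  have hgraph : ∀ m ∈ S, m ≠ l → ∃ A : l₁ →ₗ[F] l₁, m = A.graph.map φ.toLinearMap :=
    fun m hm hne => exists_eq_map_graph hU φ (hline _ hm) (hφ ▸ hskew m hm l hl hne)
  have hinj : ∀ A ∈ {A : l₁ →ₗ[F] l₁ | A.graph.map φ.toLinearMap ∈ S},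
      ∀ B ∈ {A : l₁ →ₗ[F] l₁ | A.graph.map φ.toLinearMap ∈ S}, ∀ x, x ≠ 0 → A x = B x → A = B := by
    intro A hA B hB x hx hAB
    have hmA : φ (x, A x) ∈ A.graph.map φ.toLinearMap := (apply_mem_map_graph φ A).2 rfl
    have hmB : φ (x, A x) ∈ B.graph.map φ.toLinearMap := (apply_mem_map_graph φ B).2 hAB
    by_cases heq : A.graph.map φ.toLinearMap = B.graph.map φ.toLinearMap
    · refine LinearMap.ext fun z => ?_
      have : φ (z, A z) ∈ A.graph.map φ.toLinearMap := (apply_mem_map_graph φ A).2 rfl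
      rw [heq] at this
      exact (apply_mem_map_graph φ B).1 this
    · have : φ (x, A x) ∈ A.graph.map φ.toLinearMap ⊓ B.graph.map φ.toLinearMap := ⟨hmA, hmB⟩
      rw [hskew _ hA _ hB heq, Submodule.mem_bot, LinearEquiv.map_eq_zero_iff,
        Prod.mk_eq_zero] at this
      exact absurd this.1 hx
  obtain ⟨T, hT, ⟨c, d, hcd⟩, hC⟩ := exists_linear_span_of_affine hU
    {A : l₁ →ₗ[F] l₁ | A.graph.map φ.toLinearMap ∈ S}
    (by have := rulingLine_some φ (0 : F)
        rw [zero_smul, hφ0] at this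
        rwa [Set.mem_ofPred_eq, ← this])
    (by have := rulingLine_some φ (1 : F)
        rw [one_smul, hφ1] at this
        rwa [Set.mem_ofPred_eq, ← this])
    hinj
    (by
      intro x hx y
      obtain ⟨m, hm, hxy⟩ := hspread.exists_mem hF (v := φ (x, y)) (by
        rw [Ne, LinearEquiv.map_eq_zero_iff, Prod.mk_eq_zero]
        exact fun h => hx h.1)
      have hml : m ≠ l := by
        rintro rfl
        rw [← hφ, mem_rulingLine] at hxy
        obtain ⟨z, hz⟩ := hxy
        have := congrArg Prod.fst (φ.injective hz)
        simp [projCoord] at this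
        exact hx this.symm
      obtain ⟨A, rfl⟩ := hgraph m hm hml
      exact ⟨A, hm, ((apply_mem_map_graph φ A).1 hxy).symm⟩)
    (by
      intro A hA B hB t
      by_cases hAB : A = B
      · have hBB : B + t • (B - B) = B := LinearMap.ext fun z => by simp
        rwa [hAB, hBB]
      · refine hS.add_smul_sub_mem hF hU hφS hA hB (fun x hx => ?_) t
        by_contra hne
        exact hAB (hinj A hA B hB x hne hx))
  have hval : ∀ x y, (φ.toLinearMap ∘ₗ T.prodMap T ∘ₗ φ.symm.toLinearMap) (φ (x, y)) =
      φ (T x, T y) := fun x y => by simp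
  refine ⟨φ.toLinearMap ∘ₗ T.prodMap T ∘ₗ φ.symm.toLinearMap, fun a v hv => ?_,
    ⟨c, d, fun v => ?_⟩, fun m hm v hv => ?_⟩
  · obtain ⟨⟨x, y⟩, rfl⟩ := φ.surjective v
    have h := φ.injective ((by simpa using hv : φ (T x, T y) = a • φ (x, y)).trans
      (map_smul φ a _).symm)
    rw [hT a x (congrArg Prod.fst h), hT a y (congrArg Prod.snd h)]
    exact map_zero φ
  · obtain ⟨⟨x, y⟩, rfl⟩ := φ.surjective v
    rw [hval, hval, hcd, hcd, ← map_smul φ, ← map_smul φ, ← map_add φ]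
    rfl
  · obtain ⟨⟨x, y⟩, rfl⟩ := φ.surjective v
    rw [hval]
    by_cases hml : m = l
    · subst hml
      rw [← hφ, mem_rulingLine] at hv ⊢
      obtain ⟨z, hz⟩ := hv
      refine ⟨T y, ?_⟩
      have := congrArg Prod.fst (φ.injective hz)
      simp [projCoord] at this
      simp [projCoord, ← this]
    · obtain ⟨A, rfl⟩ := hgraph m hm hml
      obtain ⟨a, b, hab⟩ := hC A hm
      rw [apply_mem_map_graph] at hv ⊢
      rw [hv, hab]
      simp

open Polynomial in
theorem exists_algebraMap_eq_of_pow_card_eq {F K : Type*} [Field F] [Fintype F] [Field K]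
    [Algebra F K] {x : K} (hx : x ^ Fintype.card F = x) : ∃ a : F, algebraMap F K a = x := by
  classical
  by_contra hne
  have hq : 1 < Fintype.card F := Fintype.one_lt_card
  let Z : Finset K := insert x (Finset.univ.image (algebraMap F K))
  have hZ : Z.card = Fintype.card F + 1 := by
    rw [Finset.card_insert_of_notMem (by simpa using hne),
      Finset.card_image_of_injective _ (algebraMap F K).injective, Finset.card_univ]
  have hle : Z.card ≤ (X ^ Fintype.card F - X : K[X]).natDegree := by
    refine card_le_degree_of_subset_roots fun z hz => ?_
    rw [mem_roots (FiniteField.X_pow_card_sub_X_ne_zero K hq), IsRoot.def, eval_sub, eval_pow,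
      eval_X, sub_eq_zero]
    rcases Finset.mem_insert.1 hz with rfl | hz
    · exact hx
    · obtain ⟨a, -, rfl⟩ := Finset.mem_image.1 hz
      rw [← map_pow, FiniteField.pow_card]
  rw [FiniteField.X_pow_card_sub_X_natDegree_eq K hq] at hle
  omega

open Polynomial in
/-- A quadratic polynomial over `F` without roots acquires a root in a quadratic extension. -/
theorem exists_root_of_finrank_two {F K : Type*} [Field F] [Field K] [Finite K] [Algebra F K]
    (hK : Module.finrank F K = 2) (c d : F) (h : ∀ a : F, a ^ 2 ≠ c + d * a) :
    ∃ x : K, x ^ 2 = algebraMap F K c + algebraMap F K d * x := by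
  let p : F[X] := X ^ 2 - C d * X - C c
  have hdeg : p.natDegree = 2 := by
    simp only [p]
    compute_degree!
  have hirr : Irreducible p := by
    refine irreducible_of_degree_le_three_of_not_isRoot (by simp [hdeg]) fun a ha => h a ?_
    simp only [p, IsRoot.def, eval_sub, eval_pow, eval_X, eval_mul, eval_C] at ha
    linear_combination ha
  have : Fact (Irreducible p) := ⟨hirr⟩
  have hrank : Module.finrank F (AdjoinRoot p) = 2 :=
    finrank_quotient_span_eq_natDegree.trans hdeg
  obtain ⟨f⟩ := FiniteField.nonempty_algHom_of_finrank_dvd (F := F) (K := AdjoinRoot p) (L := K)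
    (by rw [hrank, hK])
  refine ⟨f (AdjoinRoot.root p), ?_⟩
  have h0 : aeval (f (AdjoinRoot.root p)) p = 0 := by
    rw [aeval_algHom_apply, AdjoinRoot.aeval_eq, AdjoinRoot.mk_self, map_zero]
  simp only [p, map_sub, map_mul, map_pow, aeval_X, aeval_C] at h0
  linear_combination h0

section Embedding

variable {F K : Type*} [Field F] [Field K] [Algebra F K]

@[simp]
theorem embVec_apply (v : Fin 4 → F) (i : Fin 4) : embVec F K v i = algebraMap F K (v i) := rfl

theorem embVec_smul (a : F) (v : Fin 4 → F) :
    embVec F K (a • v) = algebraMap F K a • embVec F K v := by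
  ext i
  simp

/-- `1` and `μ` are linearly independent over `F` if `μ` is not in `F`. -/
theorem embVec_add_smul_inj {μ : K} (hμ : ∀ a : F, algebraMap F K a ≠ μ) {x y x' y' : Fin 4 → F}
    (h : embVec F K x + μ • embVec F K y = embVec F K x' + μ • embVec F K y') :
    x = x' ∧ y = y' := by
  have hinj := (algebraMap F K).injective
  have hi : ∀ i, y i = y' i ∧ x i = x' i := fun i => by
    have hi := congrFun h i
    simp only [Pi.add_apply, Pi.smul_apply, embVec_apply, smul_eq_mul] at hi
    have hy : y i = y' i := by
      by_contra hne
      have hne' : algebraMap F K (y i) - algebraMap F K (y' i) ≠ 0 :=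
        sub_ne_zero.2 (hinj.ne hne)
      apply hμ ((x' i - x i) / (y i - y' i))
      rw [map_div₀, map_sub, map_sub, div_eq_iff hne']
      linear_combination -hi
    refine ⟨hy, hinj ?_⟩
    rw [hy] at hi
    exact add_right_cancel hi
  exact ⟨funext fun i => (hi i).2, funext fun i => (hi i).1⟩

end Embedding

/-- For every regular spread S of PG(3,q) there is a line L of PG(3,q²) (a
2-dimensional GF(q²)-subspace of GF(q²)^4) disjoint from PG(3,q) — no nonzero
vector of L is a GF(q²)-scalar multiple of a vector with all coordinates in
GF(q) — such that the lines of S are exactly the lines P P^q, i.e. the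
GF(q)-rational parts of the spans ⟨P, σ(P)⟩ for nonzero P ∈ L, where σ is the
coordinatewise Frobenius. -/
theorem regular_spread_from_line (q : ℕ) (F K : Type) [Field F] [Field K]
    [Fintype F] [Fintype K] [Algebra F K]
    (hF : Fintype.card F = q) (hK : Fintype.card K = q ^ 2)
    (S : Set (Submodule F (Fin 4 → F)))
    (hS : IsRegularSpread q S) :
    ∃ L : Submodule K (Fin 4 → K),
      Module.finrank K L = 2 ∧
      (∀ v ∈ L, v ≠ 0 → ∀ (c : K) (w : Fin 4 → F), v ≠ c • (embVec F K) w) ∧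
      S = {l | ∃ P, P ∈ L ∧ P ≠ 0 ∧
        l = Submodule.comap (embVec F K)
          ((Submodule.span K {P, frobVec q P}).restrictScalars F)} := by
  obtain ⟨T, hT, ⟨c, d, hquad⟩, hinv⟩ := hS.exists_invariant hF
  have hcover : ∀ v : Fin 4 → F, v ≠ 0 → ∃ l ∈ S, v ∈ l := fun v hv => hS.1.exists_mem hF hv
  have hline := hS.1.2.1
  have hq : 1 < q := hF ▸ Fintype.one_lt_card
  have hrank : Module.finrank F K = 2 := by
    have := Module.card_eq_pow_finrank (K := F) (V := K)
    rw [hF, hK] at this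
    exact (Nat.pow_right_injective hq this).symm
  have hroot : ∀ a : F, a ^ 2 ≠ c + d * a := fun a ha => by
    have hv : ∀ v : Fin 4 → F, v = 0 := fun v => by
      refine hT (d - a) v (sub_eq_zero.1 (hT a _ ?_))
      rw [map_sub, map_smul, hquad]
      have : c = a * (a - d) := by linear_combination -ha
      rw [this]
      module
    have := congrFun (hv fun _ => 1) 0
    simp at this
  obtain ⟨μ, hμ⟩ := exists_root_of_finrank_two (K := K) hrank c d hroot
  obtain ⟨σ, hσ⟩ : ∃ σ : K →ₐ[F] K, ∀ x, σ x = x ^ q :=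
    ⟨FiniteField.frobeniusAlgHom F K, fun x => by simp [hF]⟩
  have hσσ : ∀ x, σ (σ x) = x := fun x => by
    rw [hσ, hσ, ← pow_mul, ← sq, ← hK, FiniteField.pow_card]
  have hfix : ∀ x, σ x = x → ∃ a : F, algebraMap F K a = x := fun x hx =>
    exists_algebraMap_eq_of_pow_card_eq (by rw [hF, ← hσ, hx])
  have hμF : ∀ a : F, algebraMap F K a ≠ μ := by
    rintro a rfl
    exact hroot a ((algebraMap F K).injective (by simpa using hμ))
  have hne : μ - σ μ ≠ 0 := fun h => by
    obtain ⟨a, ha⟩ := hfix μ (sub_eq_zero.1 h).symm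
    exact hμF a ha
  have hsum : σ μ = algebraMap F K d - μ := by
    have h1 : (σ μ) ^ 2 = algebraMap F K c + algebraMap F K d * σ μ := by
      rw [← map_pow, hμ, map_add, map_mul, AlgHom.commutes, AlgHom.commutes]
    have h2 : (μ - σ μ) * (μ + σ μ - algebraMap F K d) = 0 := by linear_combination hμ - h1
    have := (mul_eq_zero.1 h2).resolve_left hne
    linear_combination this
  have hdecomp : ∀ k : K, ∃ a b : F, k = algebraMap F K a + μ * algebraMap F K b := fun k => by
    obtain ⟨b, hb⟩ := hfix ((k - σ k) / (μ - σ μ)) (by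
      rw [map_div₀, map_sub, map_sub, hσσ, hσσ, ← neg_sub k, ← neg_sub μ, neg_div_neg_eq])
    have hb' : algebraMap F K b * (μ - σ μ) = k - σ k := by rw [hb, div_mul_cancel₀ _ hne]
    obtain ⟨a, ha⟩ := hfix (k - μ * algebraMap F K b) (by
      rw [map_sub, map_mul, AlgHom.commutes]
      linear_combination hb')
    exact ⟨a, b, by rw [ha]; ring⟩
  -- The point of `L` attached to a rational vector.
  let g : (Fin 4 → F) →ₗ[F] (Fin 4 → K) :=
    embVec F K ∘ₗ (T - d • LinearMap.id) + (LinearMap.lsmul K (Fin 4 → K) μ).restrictScalars F ∘ₗ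
      embVec F K
  have hg : ∀ v, g v = embVec F K (T v - d • v) + μ • embVec F K v := fun v => rfl
  have hgμ : ∀ v, μ • g v = g (T v) := fun v => by
    rw [hg, hg, hquad]
    simp only [map_sub, map_add, embVec_smul, smul_add, smul_sub, smul_smul]
    rw [← sq, hμ]
    module
  have hgK : ∀ (k : K) v, ∃ w, k • g v = g w := fun k v => by
    obtain ⟨a, b, rfl⟩ := hdecomp k
    refine ⟨a • v + b • T v, ?_⟩
    rw [map_add, map_smul, map_smul, ← hgμ, add_smul, mul_comm, mul_smul, algebraMap_smul,
      algebraMap_smul]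
  have hginj : Function.Injective g := by
    intro v w h
    rw [hg, hg] at h
    exact (embVec_add_smul_inj hμF h).2
  have hfrob : ∀ v, frobVec q (g v) = g v - (μ - σ μ) • embVec F K v := fun v => by
    ext i
    have hi : frobVec q (g v) i = σ (g v i) := (hσ _).symm
    rw [hi, hg]
    simp only [Pi.add_apply, Pi.sub_apply, Pi.smul_apply, embVec_apply, smul_eq_mul, map_add,
      map_mul, AlgHom.commutes]
    ring
  have hcomap : ∀ l ∈ S, ∀ v ∈ l, v ≠ 0 → l = Submodule.comap (embVec F K)
      ((Submodule.span K {g v, frobVec q (g v)}).restrictScalars F) := by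
    intro l hl v hv hv0
    have hTv := hinv l hl v hv
    ext z
    rw [Submodule.mem_comap, Submodule.restrictScalars_mem]
    constructor
    · intro hz
      obtain ⟨a, b, rfl⟩ := exists_eq_smul_add_smul (hline l hl) hv hTv (fun a b hab => by
        have hb : b = 0 := by
          by_contra hb
          refine hv0 (hT (-(b⁻¹ * a)) v ?_)
          rw [← inv_smul_smul₀ hb (T v), eq_neg_of_add_eq_zero_right hab]
          module
        subst hb
        simpa [hv0] using hab) hz
      have h1 : embVec F K v ∈ Submodule.span K {g v, frobVec q (g v)} := by
        refine Submodule.mem_span_pair.2 ⟨(μ - σ μ)⁻¹, -(μ - σ μ)⁻¹, ?_⟩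
        rw [hfrob, smul_sub, smul_smul, neg_mul, inv_mul_cancel₀ hne]
        module
      have h2 : embVec F K (T v) ∈ Submodule.span K {g v, frobVec q (g v)} := by
        have : embVec F K (T v) = g v + (algebraMap F K d - μ) • embVec F K v := by
          rw [hg, map_sub, embVec_smul]
          module
        rw [this]
        exact add_mem (Submodule.subset_span (by simp)) (Submodule.smul_mem _ _ h1)
      rw [map_add, embVec_smul, embVec_smul]
      exact add_mem (Submodule.smul_mem _ _ h1) (Submodule.smul_mem _ _ h2)
    · intro hz
      obtain ⟨α, β, hαβ⟩ := Submodule.mem_span_pair.1 hz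
      obtain ⟨x₁, x₂, hx⟩ := hdecomp ((α + β) * (μ - algebraMap F K d) - β * (μ - σ μ))
      obtain ⟨y₁, y₂, hy⟩ := hdecomp (α + β)
      have hz' : embVec F K z + μ • embVec F K 0 =
          embVec F K (x₁ • v + y₁ • T v) + μ • embVec F K (x₂ • v + y₂ • T v) := by
        have h1 : embVec F K z = ((α + β) * (μ - algebraMap F K d) - β * (μ - σ μ)) •
            embVec F K v + (α + β) • embVec F K (T v) := by
          rw [← hαβ, hfrob, hg, map_sub, embVec_smul]
          module
        rw [h1, hx, hy]
        simp only [map_add, map_zero, embVec_smul]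
        module
      rw [(embVec_add_smul_inj hμF hz').1]
      exact add_mem (l.smul_mem _ hv) (l.smul_mem _ hTv)
  let L : Submodule K (Fin 4 → K) :=
    { carrier := Set.range g
      add_mem' := by
        rintro _ _ ⟨v, rfl⟩ ⟨w, rfl⟩
        exact ⟨v + w, map_add g v w⟩
      zero_mem' := ⟨0, map_zero g⟩
      smul_mem' := by
        rintro k _ ⟨v, rfl⟩
        obtain ⟨w, hw⟩ := hgK k v
        exact ⟨w, hw.symm⟩ }
  refine ⟨L, ?_, ?_, ?_⟩
  · have h1 : Module.finrank F L = 4 := by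
      have h2 := LinearMap.finrank_range_of_inj hginj
      rw [Module.finrank_fin_fun] at h2
      exact h2
    have h3 := Module.finrank_mul_finrank F K L
    rw [hrank, h1] at h3
    omega
  · rintro _ ⟨v, rfl⟩ hv0 k w h
    obtain ⟨a, b, rfl⟩ := hdecomp k
    have h' : embVec F K (T v - d • v) + μ • embVec F K v =
        embVec F K (a • w) + μ • embVec F K (b • w) := by
      rw [← hg, h, embVec_smul, embVec_smul]
      module
    obtain ⟨h1, h2⟩ := embVec_add_smul_inj hμF h'
    apply hv0
    have hb : b ≠ 0 := by
      rintro rfl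
      rw [zero_smul] at h2
      rw [h2, map_zero] at hv0
      exact hv0 rfl
    have hw : w = b⁻¹ • v := by rw [h2, inv_smul_smul₀ hb]
    rw [hT (d + a * b⁻¹) v ?_, map_zero]
    rw [hw] at h1
    rw [sub_eq_iff_eq_add.1 h1]
    module
  · ext l
    constructor
    · intro hl
      have : Nontrivial l := Module.nontrivial_of_finrank_pos (R := F) (by
        rw [hline l hl]
        norm_num)
      obtain ⟨⟨v, hv⟩, hv0⟩ := exists_ne (0 : l)
      have hv0' : v ≠ 0 := fun h => hv0 (Subtype.ext h)
      exact ⟨g v, ⟨v, rfl⟩, (map_ne_zero_iff g hginj).2 hv0', hcomap l hl v hv hv0'⟩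
    · rintro ⟨_, ⟨v, rfl⟩, hv0, rfl⟩
      have hv0' : v ≠ 0 := (map_ne_zero_iff g hginj).1 hv0
      obtain ⟨l, hl, hv⟩ := hcover v hv0'
      rw [← hcomap l hl v hv hv0']
      exact hl
end
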